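/- Let k ≥ 0 and c, p, q ≥ 1 be integers. Then there exists an integer ℓ ≥ 0 such that for every finite simple graph G admitting a (p,q)-path-decomposition, and all sets S, T ⊆ V(G), either (i) there are k+1 paths of G between S and T, pairwise at distance at least c in G, or (ii) there is a set X ⊆ V(G) with |X| ≤ k such that every path of G between S and T contains a vertex at distance at most ℓ in G from some member of X. -/

import Mathlib

open SimpleGraph

/-- The distance in a graph `G` between two sets of vertices (`⊤` if no connecting walk). -/
noncomputable def eSetDist {V : Type*} (G : SimpleGraph V) (A B : Set V) : ℕ∞ :=
  sInf {n : ℕ∞ | ∃ (a b : V) (w : G.Walk a b), a ∈ A ∧ b ∈ B ∧ (w.length : ℕ∞) = n}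

/-- `G` admits a `(p,q)`-path-decomposition: a family `(B t : t ∈ L)` of sets of vertices
indexed by a linearly ordered set `L`, whose induced subgraphs cover `G`, satisfying the
interpolation property, and such that each bag is the union of at most `p` sets each of
diameter at most `q` in `G`. -/
def HasPQPathDecomp {V : Type*} (G : SimpleGraph V) (p q : ℕ) : Prop :=
  ∃ (L : Type) (ord : LinearOrder L) (B : L → Set V),
    (∀ v : V, ∃ t, v ∈ B t) ∧
    (∀ u v : V, G.Adj u v → ∃ t, u ∈ B t ∧ v ∈ B t) ∧
    (∀ t₁ t₂ t₃ : L, ord.le t₁ t₂ → ord.le t₂ t₃ → B t₁ ∩ B t₃ ⊆ B t₂) ∧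
    (∀ t : L, ∃ 𝒜 : Finset (Set V), 𝒜.card ≤ p ∧ B t = ⋃ A ∈ 𝒜, A ∧
      ∀ A ∈ 𝒜, ∀ x ∈ A, ∀ y ∈ A, eSetDist G {x} {y} ≤ (q : ℕ∞))

namespace CM

/-- `x`, `y` joined inside `U` by a walk of length at most `n`. -/
def NI {V : Type*} (G : SimpleGraph V) (U : Set V) (n : ℕ) (x y : V) : Prop :=
  ∃ w : G.Walk x y, w.length ≤ n ∧ ∀ v ∈ w.support, v ∈ U

def Nr {V : Type*} (G : SimpleGraph V) (n : ℕ) (x y : V) : Prop :=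
  ∃ w : G.Walk x y, w.length ≤ n

def Conn {V : Type*} (G : SimpleGraph V) (U : Set V) (x y : V) : Prop :=
  ∃ w : G.Walk x y, ∀ v ∈ w.support, v ∈ U

def ST {V : Type*} (G : SimpleGraph V) (S T Z : Set V) : Prop :=
  ∃ a ∈ S, ∃ b ∈ T, Conn G Z a b

def Far {V : Type*} (G : SimpleGraph V) (c : ℕ) (A B : Set V) : Prop :=
  ∀ a ∈ A, ∀ b ∈ B, ¬ Nr G c a b

variable {V : Type*} {G : SimpleGraph V} {U U' : Set V} {n m : ℕ} {x y z : V}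

theorem Conn.refl (h : x ∈ U) : Conn G U x x := ⟨.nil, by simpa using h⟩
theorem Conn.left (h : Conn G U x y) : x ∈ U := by
  obtain ⟨w, hw⟩ := h; exact hw _ w.start_mem_support
theorem Conn.right (h : Conn G U x y) : y ∈ U := by
  obtain ⟨w, hw⟩ := h; exact hw _ w.end_mem_support
theorem Conn.symm (h : Conn G U x y) : Conn G U y x := by
  obtain ⟨w, hw⟩ := h; exact ⟨w.reverse, by simpa using hw⟩
theorem Conn.trans (h : Conn G U x y) (h' : Conn G U y z) : Conn G U x z := by
  obtain ⟨w, hw⟩ := h; obtain ⟨w', hw'⟩ := h'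
  refine ⟨w.append w', fun v hv => ?_⟩
  rw [Walk.mem_support_append_iff] at hv
  exact hv.elim (hw v) (hw' v)
theorem Conn.mono (hU : U ⊆ U') (h : Conn G U x y) : Conn G U' x y := by
  obtain ⟨w, hw⟩ := h; exact ⟨w, fun v hv => hU (hw v hv)⟩
theorem Conn.adj (h : G.Adj x y) (hx : x ∈ U) (hy : y ∈ U) : Conn G U x y :=
  ⟨h.toWalk, by simp [hx, hy]⟩

theorem NI.refl (h : x ∈ U) : NI G U n x x := ⟨.nil, by simp, by simpa using h⟩
theorem NI.conn (h : NI G U n x y) : Conn G U x y := by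
  obtain ⟨w, _, hw⟩ := h; exact ⟨w, hw⟩
theorem Conn.ni (h : Conn G U x y) : ∃ n, NI G U n x y := by
  obtain ⟨w, hw⟩ := h; exact ⟨_, w, le_rfl, hw⟩
theorem NI.left (h : NI G U n x y) : x ∈ U := h.conn.left
theorem NI.right (h : NI G U n x y) : y ∈ U := h.conn.right
theorem NI.symm (h : NI G U n x y) : NI G U n y x := by
  obtain ⟨w, hl, hw⟩ := h; exact ⟨w.reverse, by simpa using hl, by simpa using hw⟩
theorem NI.trans (h : NI G U n x y) (h' : NI G U m y z) : NI G U (n + m) x z := by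
  obtain ⟨w, hl, hw⟩ := h; obtain ⟨w', hl', hw'⟩ := h'
  refine ⟨w.append w', by rw [Walk.length_append]; omega, fun v hv => ?_⟩
  rw [Walk.mem_support_append_iff] at hv
  exact hv.elim (hw v) (hw' v)
theorem NI.mono (hU : U ⊆ U') (hn : n ≤ m) (h : NI G U n x y) : NI G U' m x y := by
  obtain ⟨w, hl, hw⟩ := h; exact ⟨w, hl.trans hn, fun v hv => hU (hw v hv)⟩
theorem NI.nr (h : NI G U n x y) : Nr G n x y := by
  obtain ⟨w, hl, hw⟩ := h; exact ⟨w, hl⟩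
theorem Nr.ni (h : Nr G n x y) : NI G Set.univ n x y := by
  obtain ⟨w, hl⟩ := h; exact ⟨w, hl, by simp⟩
theorem Nr.refl : Nr G n x x := ⟨.nil, by simp⟩
theorem Nr.symm (h : Nr G n x y) : Nr G n y x := h.ni.symm.nr
theorem Nr.trans (h : Nr G n x y) (h' : Nr G m y z) : Nr G (n + m) x z := (h.ni.trans h'.ni).nr
theorem Nr.mono (hn : n ≤ m) (h : Nr G n x y) : Nr G m x y := by
  obtain ⟨w, hl⟩ := h; exact ⟨w, hl.trans hn⟩
theorem Nr.zero (h : Nr G 0 x y) : x = y := by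
  obtain ⟨w, hl⟩ := h; exact Walk.eq_of_length_eq_zero (p := w) (by omega)
theorem Nr.adj (h : G.Adj x y) : Nr G 1 x y := ⟨h.toWalk, by simp⟩
theorem Far.symm {c : ℕ} {A B : Set V} (h : Far G c A B) : Far G c B A :=
  fun a ha b hb hn => h b hb a ha hn.symm
theorem Far.mono {c c' : ℕ} {A B A' B' : Set V} (h : Far G c A B) (hc : c' ≤ c) (hA : A' ⊆ A)
    (hB : B' ⊆ B) : Far G c' A' B' :=
  fun a ha b hb hn => h a (hA ha) b (hB hb) (hn.mono hc)

/-- splitting a walk at a support vertex -/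
theorem walk_split (w : G.Walk x y) {v : V} (hv : v ∈ w.support) :
    ∃ (w1 : G.Walk x v) (w2 : G.Walk v y), w1.length + w2.length = w.length ∧
      (∀ u ∈ w1.support, u ∈ w.support) ∧ (∀ u ∈ w2.support, u ∈ w.support) := by
  classical
  refine ⟨w.takeUntil v hv, w.dropUntil v hv, ?_, ?_, ?_⟩
  · rw [← Walk.length_append, Walk.take_spec]
  · exact fun u hu => w.support_takeUntil_subset_support hv hu
  · exact fun u hu => w.support_dropUntil_subset_support hv hu

theorem NI.split_num : ∀ {m n : ℕ} {x y : V}, NI G U (m + n) x y → ∃ z, NI G U m x z ∧ NI G U n z y := by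
  intro m n x y h
  obtain ⟨w, hl, hw⟩ := h
  refine ⟨w.getVert m, ⟨w.take m, ?_, ?_⟩, ⟨w.drop m, ?_, ?_⟩⟩
  · rw [Walk.take_length]; omega
  · intro v hv; exact hw v ((w.isSubwalk_take m).support_subset hv)
  · rw [Walk.drop_length]; omega
  · intro v hv; exact hw v ((w.isSubwalk_drop m).support_subset hv)

theorem Nr.split_num {m n : ℕ} {x y : V} (h : Nr G (m + n) x y) : ∃ z, Nr G m x z ∧ Nr G n z y := by
  obtain ⟨z, h1, h2⟩ := h.ni.split_num
  exact ⟨z, h1.nr, h2.nr⟩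

/-- crossing: from inside a set to outside -/
theorem Conn.exit {A : Set V} (h : Conn G U x y) (hx : x ∈ A) (hy : y ∉ A) :
    ∃ u v, G.Adj u v ∧ u ∈ A ∧ v ∉ A ∧ u ∈ U ∧ v ∈ U ∧ Conn G (U ∩ A) x u ∧ Conn G U v y := by
  obtain ⟨w, hw⟩ := h
  induction w with
  | nil => exact absurd hx hy
  | @cons a b d hab w ih =>
    have ha : a ∈ U := hw a (by simp)
    have hw' : ∀ v ∈ w.support, v ∈ U := fun v hv => hw v (by simp [hv])
    by_cases hb : b ∈ A
    · obtain ⟨u, v, h1, h2, h3, h4, h5, h6, h7⟩ := ih hb hy hw'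
      exact ⟨u, v, h1, h2, h3, h4, h5, (Conn.adj (U := U ∩ A) hab ⟨ha, hx⟩ h6.left).trans h6, h7⟩
    · exact ⟨a, b, hab, hx, hb, ha, hw' _ w.start_mem_support, Conn.refl ⟨ha, hx⟩, w, hw'⟩

/-- bag crossing -/
theorem bag_cross {L : Type*} [LinearOrder L] {B : L → Set V}
    (hE : ∀ u v : V, G.Adj u v → ∃ t, u ∈ B t ∧ v ∈ B t)
    (hI : ∀ t₁ t₂ t₃ : L, t₁ ≤ t₂ → t₂ ≤ t₃ → B t₁ ∩ B t₃ ⊆ B t₂)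
    {a b c : L} (hab : a ≤ b) (hbc : b ≤ c) (hx : x ∈ B a) (hy : y ∈ B c) (h : Conn G U x y) :
    ∃ v ∈ U, v ∈ B b := by
  by_contra hcon
  push Not at hcon
  have hyA : y ∉ {v | ∃ t, t ≤ b ∧ v ∈ B t} := by
    rintro ⟨t, ht, hyt⟩
    exact hcon y h.right (hI t b c ht hbc ⟨hyt, hy⟩)
  obtain ⟨u, v, huv, ⟨t, ht, hut⟩, hv, huU, hvU, -⟩ := h.exit (A := {v | ∃ t, t ≤ b ∧ v ∈ B t}) ⟨a, hab, hx⟩ hyA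
  obtain ⟨t', h1, h2⟩ := hE u v huv
  rcases le_total t' b with h | h
  · exact hv ⟨t', h, h2⟩
  · exact hcon u huU (hI t b t' ht h ⟨hut, h1⟩)

theorem eSetDist_le_iff : eSetDist G {x} {y} ≤ (n : ℕ∞) ↔ Nr G n x y := by
  constructor
  · intro h
    have hne : {n : ℕ∞ | ∃ (a b : V) (w : G.Walk a b), a ∈ ({x} : Set V) ∧ b ∈ ({y} : Set V) ∧ (w.length : ℕ∞) = n}.Nonempty := by
      by_contra hcon
      rw [Set.not_nonempty_iff_eq_empty] at hcon
      rw [eSetDist, hcon, sInf_empty] at h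
      exact absurd h (by simp)
    have := csInf_mem hne
    obtain ⟨a, b, w, rfl, rfl, hw⟩ := this
    refine ⟨w, ?_⟩
    rw [eSetDist, ← hw] at h
    exact_mod_cast h
  · rintro ⟨w, hw⟩
    have h1 : eSetDist G {x} {y} ≤ (w.length : ℕ∞) := sInf_le ⟨x, y, w, rfl, rfl, rfl⟩
    exact h1.trans (by exact_mod_cast hw)

theorem le_eSetDist {A B : Set V} (h : Far G n A B) : (n : ℕ∞) ≤ eSetDist G A B := by
  refine le_sInf ?_
  rintro _ ⟨a, b, w, ha, hb, rfl⟩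
  have := h a ha b hb
  by_contra hcon
  push Not at hcon
  exact this ⟨w, by exact_mod_cast hcon.le⟩

end CM
open SimpleGraph
namespace CM

variable {W : Type*} {H H' : SimpleGraph W}

theorem Conn.mono_graph {Z : Set W} {a b : W} (h : H' ≤ H) (hc : Conn H' Z a b) : Conn H Z a b := by
  obtain ⟨w, hw⟩ := hc
  exact ⟨w.mapLe h, by simpa using hw⟩

theorem conn_del {x y : W} (hH : ∀ a b, H.Adj a b → H'.Adj a b ∨ (a = x ∧ b = y) ∨ (a = y ∧ b = x))
    {Z : Set W} {a b : W} (hc : Conn H Z a b) :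
    Conn H' Z a b ∨ (Conn H' Z a x ∧ Conn H' Z y b) ∨ (Conn H' Z a y ∧ Conn H' Z x b) := by
  obtain ⟨w, hw⟩ := hc
  induction w with
  | nil => exact Or.inl (Conn.refl (hw _ (by simp)))
  | @cons a b d hab w ih =>
    have ha : a ∈ Z := hw a (by simp)
    have hw' : ∀ v ∈ w.support, v ∈ Z := fun v hv => hw v (by simp [hv])
    have hb := hw' _ w.start_mem_support
    rcases hH a b hab with h | ⟨rfl, rfl⟩ | ⟨rfl, rfl⟩
    · have h1 := Conn.adj h ha hb
      rcases ih hw' with h2 | h2 | h2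
      · exact Or.inl (h1.trans h2)
      · exact Or.inr (Or.inl ⟨h1.trans h2.1, h2.2⟩)
      · exact Or.inr (Or.inr ⟨h1.trans h2.1, h2.2⟩)
    · rcases ih hw' with h2 | h2 | h2
      · exact Or.inr (Or.inl ⟨Conn.refl ha, h2⟩)
      · exact Or.inr (Or.inl ⟨Conn.refl ha, h2.2⟩)
      · exact Or.inl h2.2
    · rcases ih hw' with h2 | h2 | h2
      · exact Or.inr (Or.inr ⟨Conn.refl ha, h2⟩)
      · exact Or.inl h2.2
      · exact Or.inr (Or.inr ⟨Conn.refl ha, h2.2⟩)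

/-- a connection either avoids a set `X` or meets it -/
theorem conn_hit {Z X : Set W} {a b : W} (h : Conn H Z a b) :
    Conn H (Z \ X) a b ∨ ∃ v ∈ X, Conn H Z a v ∧ Conn H Z v b := by
  obtain ⟨w, hw⟩ := h
  by_cases hx : ∃ v ∈ w.support, v ∈ X
  · obtain ⟨v, hv, hvX⟩ := hx
    obtain ⟨w1, w2, -, h1, h2⟩ := walk_split w hv
    exact Or.inr ⟨v, hvX, ⟨w1, fun u hu => hw u (h1 u hu)⟩, ⟨w2, fun u hu => hw u (h2 u hu)⟩⟩
  · push Not at hx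
    exact Or.inl ⟨w, fun v hv => ⟨hw v hv, hx v hv⟩⟩

/-- normal form of a family of disjoint connections into a set of the same size -/
theorem menger_norm {A : Set W} {k : ℕ} {X : Finset W} (hX : X.card = k + 1)
    (Z : Fin (k + 1) → Set W) (hZ : ∀ i, ST H A X (Z i)) (hd : ∀ i j, i ≠ j → Disjoint (Z i) (Z j)) :
    ∃ F : W → Set W, (∀ v ∈ X, ST H A {v} (F v)) ∧
      (∀ v ∈ X, ∀ v' ∈ X, v ≠ v' → Disjoint (F v) (F v')) ∧
      (∀ v ∈ X, ∀ u ∈ F v, u ≠ v → ∃ a ∈ A, Conn H (X : Set W)ᶜ a u) := by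
  classical
  choose a ha e he hc using hZ
  have hinj : Function.Injective e := by
    intro i j hij
    by_contra hne
    exact Set.disjoint_left.1 (hd i j hne) (hc i).right (hij ▸ (hc j).right)
  have himg : Finset.univ.image e = X := by
    apply Finset.eq_of_subset_of_card_le
    · intro v hv
      obtain ⟨i, -, rfl⟩ := Finset.mem_image.1 hv
      exact he i
    · rw [Finset.card_image_of_injective _ hinj, hX]; simp
  have hsur : ∀ v ∈ X, ∃ i, e i = v := by
    intro v hv
    rw [← himg] at hv
    obtain ⟨i, -, rfl⟩ := Finset.mem_image.1 hv
    exact ⟨i, rfl⟩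
  have honly : ∀ i, ∀ v ∈ Z i, v ∈ X → v = e i := by
    intro i v hv hvX
    obtain ⟨j, rfl⟩ := hsur v hvX
    by_contra hne
    have hij : i ≠ j := fun h => hne (by rw [h])
    exact Set.disjoint_left.1 (hd i j hij) hv (hc j).right
  have hFe : ∀ v, ∃ F : Set W, ∀ i, e i = v → F = {u | Conn H (Z i \ X) (a i) u} ∪ {v} := by
    intro v
    by_cases h : ∃ i, e i = v
    · obtain ⟨i, hi⟩ := h
      refine ⟨{u | Conn H (Z i \ X) (a i) u} ∪ {v}, fun j hj => ?_⟩
      rw [hinj (hi.trans hj.symm)]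
    · exact ⟨∅, fun i hi => absurd ⟨i, hi⟩ h⟩
  choose F hF using hFe
  refine ⟨F, ?_, ?_, ?_⟩
  · intro v hv
    obtain ⟨i, rfl⟩ := hsur v hv
    rw [hF _ i rfl]
    refine ⟨a i, ha i, e i, rfl, ?_⟩
    by_cases hae : a i = e i
    · rw [hae]; exact Conn.refl (Or.inr rfl)
    · obtain ⟨u, v, huv, hu, hv, -, -, h1, -⟩ := (hc i).exit (A := {w | w ≠ e i}) hae (by simp)
      have hv' : v = e i := by simpa using hv
      subst hv'
      obtain ⟨w, hw⟩ := h1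
      have key : ∀ y ∈ w.support, Conn H (Z i \ X) (a i) y := by
        intro y hy
        obtain ⟨w1, w2, -, h1, h2⟩ := walk_split w hy
        refine ⟨w1, fun t ht => ⟨(hw t (h1 t ht)).1, fun htX => ?_⟩⟩
        exact (hw t (h1 t ht)).2 (honly i t (hw t (h1 t ht)).1 htX)
      have h2 : Conn H ({u | Conn H (Z i \ X) (a i) u} ∪ {e i}) (a i) u :=
        ⟨w, fun y hy => Or.inl (key y hy)⟩
      exact h2.trans (Conn.adj huv h2.right (Or.inr rfl))
  · intro v hv v' hv' hne
    obtain ⟨i, rfl⟩ := hsur v hv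
    obtain ⟨j, rfl⟩ := hsur v' hv'
    have hij : i ≠ j := fun h => hne (by rw [h])
    refine (hd i j hij).mono ?_ ?_
    · rw [hF _ i rfl]
      rintro u (hu | rfl)
      · exact (Conn.right hu).1
      · exact (hc i).right
    · rw [hF _ j rfl]
      rintro u (hu | rfl)
      · exact (Conn.right hu).1
      · exact (hc j).right
  · intro v hv u hu hne
    obtain ⟨i, rfl⟩ := hsur v hv
    rw [hF _ i rfl] at hu
    rcases hu with hu | hu
    · exact ⟨a i, ha i, Conn.mono (fun t ht => ht.2) hu⟩
    · exact absurd hu hne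

theorem ST.symm {A B Z : Set W} (h : ST H A B Z) : ST H B A Z := by
  obtain ⟨a, ha, b, hb, h⟩ := h
  exact ⟨b, hb, a, ha, h.symm⟩

theorem ST.mono {A B Z A' B' Z' : Set W} (hA : A ⊆ A') (hB : B ⊆ B') (hZ : Z ⊆ Z')
    (h : ST H A B Z) : ST H A' B' Z' := by
  obtain ⟨a, ha, b, hb, h⟩ := h
  exact ⟨a, hA ha, b, hB hb, h.mono hZ⟩

theorem menger [Finite W] (H : SimpleGraph W) : ∀ (A B : Set W) (k : ℕ),
    (∀ X : Finset W, X.card ≤ k → ∃ Z, ST H A B Z ∧ Disjoint Z (X : Set W)) →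
    ∃ Z : Fin (k + 1) → Set W, (∀ i, ST H A B (Z i)) ∧ ∀ i j, i ≠ j → Disjoint (Z i) (Z j) := by
  classical
  cases nonempty_fintype W
  induction H using WellFoundedLT.induction with
  | ind H ih =>
  intro A B k hsep
  by_cases hbot : ∃ x y, H.Adj x y
  swap
  · push Not at hbot
    have hZ : ∀ Z, ST H A B Z → ∃ v ∈ Z, v ∈ A ∧ v ∈ B := by
      rintro Z ⟨a, ha, b, hb, w, hw⟩
      cases w with
      | nil => exact ⟨a, hw a (by simp), ha, hb⟩
      | cons h _ => exact absurd h (hbot _ _)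
    set X := Finset.univ.filter (fun v => v ∈ A ∧ v ∈ B) with hX
    have hcard : k + 1 ≤ X.card := by
      by_contra hcon
      obtain ⟨Z, hZ1, hZ2⟩ := hsep X (by omega)
      obtain ⟨v, hv, hvA⟩ := hZ Z hZ1
      exact Set.disjoint_left.1 hZ2 hv (by simp [hX, hvA])
    obtain ⟨Y, hYX, hY⟩ := Finset.exists_subset_card_eq hcard
    let f := (Finset.equivFinOfCardEq hY).symm
    refine ⟨fun i => {(f i : W)}, fun i => ?_, fun i j hij => ?_⟩
    · have := hYX (f i).2
      simp only [hX, Finset.mem_filter] at this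
      exact ⟨f i, this.2.1, f i, this.2.2, Conn.refl rfl⟩
    · rw [Set.disjoint_singleton]
      intro h
      exact hij (f.injective (Subtype.ext h))
  · obtain ⟨x, y, hxy⟩ := hbot
    set H' := H.deleteEdges {s(x, y)} with hH'
    have hle : H' ≤ H := H.deleteEdges_le _
    have hnot : ¬ H'.Adj x y := by simp [hH']
    have hlt : H' < H := lt_of_le_of_ne hle (fun h => hnot (h ▸ hxy))
    have hH : ∀ a b, H.Adj a b → H'.Adj a b ∨ (a = x ∧ b = y) ∨ (a = y ∧ b = x) := by
      intro a b hab
      by_cases h : s(a, b) = s(x, y)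
      · right; simpa [Sym2.eq_iff] using h
      · left; simp only [hH', deleteEdges_adj, Set.mem_singleton_iff]; exact ⟨hab, h⟩
    have ih' := ih H' hlt
    by_cases hs : ∀ X : Finset W, X.card ≤ k → ∃ Z, ST H' A B Z ∧ Disjoint Z (X : Set W)
    · obtain ⟨Z, h1, h2⟩ := ih' A B k hs
      refine ⟨Z, fun i => ?_, h2⟩
      obtain ⟨a, ha, b, hb, hc⟩ := h1 i
      exact ⟨a, ha, b, hb, hc.mono_graph hle⟩
    push Not at hs
    obtain ⟨X, hXk, hX⟩ := hs
    -- no H'-connection in the complement of X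
    have hX0 : ∀ a ∈ A, ∀ b ∈ B, ¬ Conn H' (X : Set W)ᶜ a b := by
      intro a ha b hb hc
      exact hX _ ⟨a, ha, b, hb, hc⟩ disjoint_compl_left
    obtain ⟨Z0, ⟨a0, ha0, b0, hb0, hc0⟩, hZ0⟩ := hsep X hXk
    have hc0 : Conn H (X : Set W)ᶜ a0 b0 := hc0.mono (Set.subset_compl_iff_disjoint_right.2 hZ0)
    -- orientation
    have hor : ∃ x y, H.Adj x y ∧ (∀ a b, H.Adj a b → H'.Adj a b ∨ (a = x ∧ b = y) ∨ (a = y ∧ b = x))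
        ∧ Conn H' (X : Set W)ᶜ a0 x ∧ Conn H' (X : Set W)ᶜ y b0 := by
      rcases conn_del hH hc0 with h | h | h
      · exact absurd h (hX0 a0 ha0 b0 hb0)
      · exact ⟨x, y, hxy, hH, h⟩
      · exact ⟨y, x, hxy.symm, fun a b hab => (hH a b hab).imp id Or.symm, h⟩
    clear hH hxy hnot
    obtain ⟨x, y, hxy, hH, hax, hyb⟩ := hor
    have hxX : x ∉ X := hax.right
    have hyX : y ∉ X := hyb.left
    have hXcard : X.card = k := by
      by_contra hne
      obtain ⟨Z, ⟨a, ha, b, hb, hc⟩, hZ⟩ := hsep (insert x X) (by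
        have := Finset.card_insert_le x X; omega)
      have hsub : Z ⊆ (X : Set W)ᶜ := fun v hv hvX =>
        Set.disjoint_left.1 hZ hv (by simp; right; exact hvX)
      have hxZ : x ∉ Z := fun hv => Set.disjoint_left.1 hZ hv (by simp)
      rcases conn_del hH hc with h | h | h
      · exact hX0 a ha b hb (h.mono hsub)
      · exact hxZ h.1.right
      · exact hxZ h.2.left
    -- A to X+x
    obtain ⟨Z1, hZ1, hd1⟩ := ih' A (insert x X : Finset W) k (by
      intro Y hY
      obtain ⟨Z, ⟨a, ha, b, hb, hc⟩, hZ⟩ := hsep Y hY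
      refine ⟨Z, ?_, hZ⟩
      rcases conn_del hH hc with h | h | h
      · rcases conn_hit (X := (X : Set W)) h with h | ⟨v, hv, h1, h2⟩
        · exact absurd (h.mono (fun t ht => ht.2)) (hX0 a ha b hb)
        · exact ⟨a, ha, v, by simp; right; exact hv, h1⟩
      · exact ⟨a, ha, x, by simp, h.1⟩
      · rcases conn_hit (X := (X : Set W)) h.1 with h | ⟨v, hv, h1, h2⟩
        · exact absurd ((h.mono (fun t ht => ht.2)).trans hyb) (hX0 a ha b0 hb0)
        · exact ⟨a, ha, v, by simp; right; exact hv, h1⟩)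
    obtain ⟨Z2, hZ2, hd2⟩ := ih' (insert y X : Finset W) B k (by
      intro Y hY
      obtain ⟨Z, ⟨a, ha, b, hb, hc⟩, hZ⟩ := hsep Y hY
      refine ⟨Z, ?_, hZ⟩
      rcases conn_del hH hc with h | h | h
      · rcases conn_hit (X := (X : Set W)) h with h | ⟨v, hv, h1, h2⟩
        · exact absurd (h.mono (fun t ht => ht.2)) (hX0 a ha b hb)
        · exact ⟨v, by simp; right; exact hv, b, hb, h2⟩
      · exact ⟨y, by simp, b, hb, h.2⟩
      · rcases conn_hit (X := (X : Set W)) h.2 with h | ⟨v, hv, h1, h2⟩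
        · exact absurd (hax.trans (h.mono (fun t ht => ht.2))) (hX0 a0 ha0 b hb)
        · exact ⟨v, by simp; right; exact hv, b, hb, h2⟩)
    obtain ⟨F, hF1, hF2, hF3⟩ := menger_norm (X := insert x X)
      (by rw [Finset.card_insert_of_notMem hxX, hXcard]) Z1 hZ1 hd1
    have hcy : (insert y X).card = k + 1 := by rw [Finset.card_insert_of_notMem hyX, hXcard]
    obtain ⟨F', hF1', hF2', hF3'⟩ := menger_norm (X := insert y X) hcy Z2 (fun i => (hZ2 i).symm) hd2
    have hcx : (insert x X).card = k + 1 := by rw [Finset.card_insert_of_notMem hxX, hXcard]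
    have hsx : ((insert x X : Finset W) : Set W)ᶜ ⊆ (X : Set W)ᶜ := by
      intro v hv hvX; exact hv (by simp; right; exact hvX)
    have hsy : ((insert y X : Finset W) : Set W)ᶜ ⊆ (X : Set W)ᶜ := by
      intro v hv hvX; exact hv (by simp; right; exact hvX)
    -- intersections
    have hint : ∀ v ∈ insert x X, ∀ w ∈ insert y X, ∀ u, u ∈ F v → u ∈ F' w → u = v ∧ u = w := by
      intro v hv w hw u hu hu'
      by_cases h1 : u = v
      · by_cases h2 : u = w
        · exact ⟨h1, h2⟩
        · exfalso
          obtain ⟨b, hb, hc⟩ := hF3' w hw u hu' h2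
          have hc := hc.mono hsy
          subst h1
          rcases Finset.mem_insert.1 hv with rfl | hv
          · exact hX0 a0 ha0 b hb (hax.trans hc.symm)
          · exact hc.right hv
      · obtain ⟨a, ha, hc⟩ := hF3 v hv u hu h1
        have hc := hc.mono hsx
        exfalso
        by_cases h2 : u = w
        · subst h2
          rcases Finset.mem_insert.1 hw with rfl | hv
          · exact hX0 a ha b0 hb0 (hc.trans hyb)
          · exact hc.right hv
        · obtain ⟨b, hb, hc'⟩ := hF3' w hw u hu' h2
          exact hX0 a ha b hb (hc.trans (hc'.mono hsy).symm)
    let f := (Finset.equivFinOfCardEq hcx).symm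
    let φ : W → W := fun v => if v = x then y else v
    have hφ : ∀ v ∈ insert x X, φ v ∈ insert y X := by
      intro v hv
      simp only [φ]
      split_ifs with h
      · simp
      · rcases Finset.mem_insert.1 hv with h' | h'
        · exact absurd h' h
        · simp [h']
    have hφi : ∀ v ∈ insert x X, ∀ w ∈ insert x X, v ≠ w → φ v ≠ φ w := by
      intro v hv w hw hne
      simp only [φ]
      split_ifs with h1 h2 h2
      · exact absurd (h1.trans h2.symm) hne
      · rintro rfl; exact hyX ((Finset.mem_insert.1 hw).resolve_left h2)
      · rintro rfl; exact hyX ((Finset.mem_insert.1 hv).resolve_left h1)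
      · exact hne
    -- crossing case
    have hcross : ∀ v ∈ insert x X, ∀ w ∈ insert x X, v ≠ w → Disjoint (F v) (F' (φ w)) := by
      intro v hv w hw hne
      rw [Set.disjoint_left]
      intro u hu hu'
      obtain ⟨h1, h2⟩ := hint v hv _ (hφ w hw) u hu hu'
      subst h1
      simp only [φ] at h2
      split_ifs at h2 with h3
      · subst h2
        rcases Finset.mem_insert.1 hv with h | h
        · exact hxy.ne h.symm
        · exact hyX h
      · exact hne h2
    refine ⟨fun i => F (f i) ∪ F' (φ (f i)), fun i => ?_, fun i j hij => ?_⟩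
    · obtain ⟨a, ha, b, rfl, hc⟩ := hF1 (f i) (f i).2
      obtain ⟨b', hb', a', ha', hc'⟩ := hF1' _ (hφ (f i) (f i).2)
      have ha' : a' = φ (f i) := ha'
      subst ha'
      refine ⟨a, ha, b', hb', ?_⟩
      have e1 := (hc.mono_graph hle).mono (Set.subset_union_left (t := F' (φ (f i))))
      have e2 := (hc'.symm.mono_graph hle).mono (Set.subset_union_right (s := F (f i)))
      refine e1.trans (Conn.trans ?_ e2)
      by_cases h : (f i : W) = x
      · have : φ (f i) = y := by simp [φ, h]
        refine Conn.adj ?_ e1.right e2.left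
        rw [this, h]; exact hxy
      · have : φ (f i) = f i := by simp [φ, h]
        rw [this] at e2 ⊢
        exact Conn.refl e2.left
    · have hne : (f i : W) ≠ f j := fun h => hij (f.injective (Subtype.ext h))
      rw [Set.disjoint_union_left, Set.disjoint_union_right, Set.disjoint_union_right]
      refine ⟨⟨hF2 _ (f i).2 _ (f j).2 hne, hcross _ (f i).2 _ (f j).2 hne⟩,
        (hcross _ (f j).2 _ (f i).2 hne.symm).symm, hF2' _ (hφ _ (f i).2) _ (hφ _ (f j).2) (hφi _ (f i).2 _ (f j).2 hne)⟩
end CM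
open SimpleGraph
namespace CM

variable {V : Type*} {G : SimpleGraph V}

def Useq (G : SimpleGraph V) (ρ D : ℕ → ℕ) (A : Set V) : ℕ → Set V
  | 0 => A
  | n + 1 => Useq G ρ D A n ∪ {v | ∃ (x y : V) (w : G.Walk x y), x ∈ Useq G ρ D A n ∧
      y ∈ Useq G ρ D A n ∧ w.length ≤ ρ n ∧ ¬ NI G (Useq G ρ D A n) (D n) x y ∧ v ∈ w.support}

def Bad (G : SimpleGraph V) (ρ D : ℕ → ℕ) (A : Set V) (n : ℕ) (x y : V) : Prop :=
  x ∈ Useq G ρ D A n ∧ y ∈ Useq G ρ D A n ∧ Nr G (ρ n) x y ∧ ¬ NI G (Useq G ρ D A n) (D n) x y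

def Nw (G : SimpleGraph V) (ρ D : ℕ → ℕ) (A : Set V) : ℕ → V → Prop
  | 0, v => v ∈ A
  | n + 1, v => v ∈ Useq G ρ D A (n + 1) ∧ v ∉ Useq G ρ D A n

theorem Bad.symm {ρ D : ℕ → ℕ} {A : Set V} {n : ℕ} {x y : V} (h : Bad G ρ D A n x y) :
    Bad G ρ D A n y x := ⟨h.2.1, h.1, h.2.2.1.symm, fun h' => h.2.2.2 h'.symm⟩

theorem NI.conn_mem {U : Set V} {n : ℕ} {x y : V} (h : NI G U n x y) :
    Conn G {u | NI G U n x u ∧ NI G U n u y} x y := by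
  obtain ⟨w, hl, hw⟩ := h
  refine ⟨w, fun v hv => ?_⟩
  obtain ⟨w1, w2, h0, h1, h2⟩ := walk_split w hv
  exact ⟨⟨w1, by omega, fun u hu => hw u (h1 u hu)⟩, ⟨w2, by omega, fun u hu => hw u (h2 u hu)⟩⟩

section
variable {ρ D : ℕ → ℕ} {A : Set V}

theorem Useq_succ (n : ℕ) : Useq G ρ D A n ⊆ Useq G ρ D A (n + 1) := fun _ h => Or.inl h

theorem Useq_mono {m n : ℕ} (h : m ≤ n) : Useq G ρ D A m ⊆ Useq G ρ D A n := by
  induction h with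
  | refl => exact le_rfl
  | step _ ih => exact ih.trans (Useq_succ _)

theorem claim1 {n : ℕ} (hD : ρ n ≤ D n) {x y : V} (hx : x ∈ Useq G ρ D A n)
    (hy : y ∈ Useq G ρ D A n) (h : Nr G (ρ n) x y) : NI G (Useq G ρ D A (n + 1)) (D n) x y := by
  by_cases hb : NI G (Useq G ρ D A n) (D n) x y
  · exact hb.mono (Useq_succ n) le_rfl
  · obtain ⟨w, hw⟩ := h
    exact ⟨w, hw.trans hD, fun v hv => Or.inr ⟨x, y, w, hx, hy, hw, hb, hv⟩⟩

theorem claim2 {n : ℕ} {v : V} (hv : Nw G ρ D A (n + 1) v) :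
    ∃ x y a b, Bad G ρ D A n x y ∧ a + b ≤ ρ n ∧ NI G (Useq G ρ D A (n + 1)) a v x ∧
      NI G (Useq G ρ D A (n + 1)) b v y := by
  obtain ⟨h | ⟨x, y, w, hx, hy, hw, hb, hvw⟩, hn⟩ := hv
  · exact absurd h hn
  · obtain ⟨w1, w2, h0, h1, h2⟩ := walk_split w hvw
    refine ⟨x, y, w1.length, w2.length, ⟨hx, hy, ⟨w, hw⟩, hb⟩, by omega, NI.symm ⟨w1, le_rfl, ?_⟩,
      ⟨w2, le_rfl, ?_⟩⟩
    · exact fun u hu => Or.inr ⟨x, y, w, hx, hy, hw, hb, h1 u hu⟩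
    · exact fun u hu => Or.inr ⟨x, y, w, hx, hy, hw, hb, h2 u hu⟩

theorem claim2' {n : ℕ} {v : V} (hv : Nw G ρ D A (n + 1) v) :
    ∃ x y, Bad G ρ D A n x y ∧ NI G (Useq G ρ D A (n + 1)) (ρ n / 2) v x := by
  obtain ⟨x, y, a, b, hb, hab, h1, h2⟩ := claim2 hv
  rcases le_total a b with h | h
  · exact ⟨x, y, hb, h1.mono le_rfl (by omega)⟩
  · exact ⟨y, x, hb.symm, h2.mono le_rfl (by omega)⟩

theorem claim3 {n : ℕ} (hD : ρ n ≤ D n) (hρ : 8 * ρ (n + 1) ≤ ρ n) (hDD : D n + ρ n ≤ D (n + 1))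
    {x y : V} (h : Bad G ρ D A (n + 1) x y) : x ∉ Useq G ρ D A n := by
  intro hx
  obtain ⟨-, hy, hr, hni⟩ := h
  apply hni
  by_cases hy' : y ∈ Useq G ρ D A n
  · exact (claim1 hD hx hy' (hr.mono (by omega))).mono le_rfl (by omega)
  · obtain ⟨z, z', hb, hz⟩ := claim2' (G := G) ⟨hy, hy'⟩
    have := claim1 hD hx hb.1 ((hr.trans hz.nr).mono (by omega))
    exact (this.trans hz.symm).mono le_rfl (by omega)

theorem bad_nw {n : ℕ} (hD : ∀ i, ρ i ≤ D i) (hρ : ∀ i, i < n → 8 * ρ (i + 1) ≤ ρ i)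
    (hDD : ∀ i, D i + ρ i ≤ D (i + 1)) {x y : V} (h : Bad G ρ D A n x y) : Nw G ρ D A n x := by
  cases n with
  | zero => exact h.1
  | succ n => exact ⟨h.1, claim3 (hD n) (hρ n (by omega)) (hDD n) h⟩

theorem sort3 {L : Type*} [LinearOrder L] (t : Fin 3 → L) :
    ∃ a b c, a ≠ b ∧ b ≠ c ∧ t a ≤ t b ∧ t b ≤ t c := by
  rcases le_total (t 0) (t 1) with h1 | h1 <;> rcases le_total (t 1) (t 2) with h2 | h2 <;>
    rcases le_total (t 0) (t 2) with h3 | h3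
  · exact ⟨0, 1, 2, by decide, by decide, h1, h2⟩
  · exact ⟨0, 1, 2, by decide, by decide, h1, h2⟩
  · exact ⟨0, 2, 1, by decide, by decide, h3, h2⟩
  · exact ⟨2, 0, 1, by decide, by decide, h3, h1⟩
  · exact ⟨1, 0, 2, by decide, by decide, h1, h3⟩
  · exact ⟨1, 2, 0, by decide, by decide, h2, h3⟩
  · exact ⟨2, 1, 0, by decide, by decide, h2, h1⟩
  · exact ⟨2, 1, 0, by decide, by decide, h2, h1⟩

theorem phi_step {L : Type*} [LinearOrder L] {B : L → Set V}
    (hE : ∀ u v : V, G.Adj u v → ∃ t, u ∈ B t ∧ v ∈ B t)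
    (hI : ∀ t₁ t₂ t₃ : L, t₁ ≤ t₂ → t₂ ≤ t₃ → B t₁ ∩ B t₃ ⊆ B t₂)
    {U0 U1 U3 : Set V} (h01 : U0 ⊆ U1) (h13 : U1 ⊆ U3) {M M' r s q m : ℕ}
    (hs : 4 * s ≤ r) (hq : 4 * q ≤ r) (hM : M + 3 * r ≤ M')
    (x : V) (y c : Fin 3 → V) (t : Fin 3 → L) (f : Fin 3 → Fin (m + 1) → V)
    (hft : ∀ β i, f β i ∈ B (t β))
    (hfq : ∀ β i j, i ≠ j → ¬ Nr G q (f β i) (f β j))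
    (h1 : ∀ β, NI G U3 s (y β) x) (h2 : ∀ β, NI G U1 (r / 2) (y β) (c β))
    (h3 : ∀ β i, NI G U0 M (f β i) (c β))
    (sep : ∀ β β', β ≠ β' → ∀ w ∈ U0, ∀ w' ∈ U0, NI G U1 (M + r) w (y β) →
      NI G U1 (M + r) w' (y β') → ¬ Nr G r w w') :
    ∃ (t : L) (f : Fin (m + 2) → V), (∀ i, f i ∈ B t) ∧ (∀ i, NI G U3 M' (f i) x) ∧
      ∀ i j, i ≠ j → ¬ Nr G q (f i) (f j) := by
  set Arm : Fin 3 → Set V := fun β => {u | (∃ w ∈ U0, NI G U1 (M + r) w (y β) ∧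
    Nr G (r / 2 + s) u w) ∧ NI G U3 M' u x} with hArm
  have hfb : ∀ β u, NI G U0 M u (c β) → NI G U1 (M + r) u (y β) := fun β u hu =>
    ((hu.mono h01 le_rfl).trans (h2 β).symm).mono le_rfl (by omega)
  have hc0 : ∀ β, c β ∈ U0 := fun β => (h3 β 0).right
  have hcb : ∀ β, NI G U1 (M + r) (c β) (y β) := fun β => hfb β _ (NI.refl (hc0 β))
  have harm1 : ∀ β u, NI G U0 M u (c β) → u ∈ Arm β := by
    intro β u hu
    refine ⟨⟨u, hu.left, hfb β u hu, Nr.refl⟩, ?_⟩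
    exact (((hu.mono (h01.trans h13) le_rfl).trans ((h2 β).symm.mono h13 le_rfl)).trans (h1 β)).mono
      le_rfl (by omega)
  have hconn : ∀ β, Conn G (Arm β) (f β 0) x := by
    intro β
    have e1 : Conn G (Arm β) (f β 0) (c β) := by
      refine (h3 β 0).conn_mem.mono ?_
      rintro u ⟨-, hu⟩
      exact harm1 β u hu
    have e2 : Conn G (Arm β) (c β) (y β) := by
      refine (h2 β).symm.conn_mem.mono ?_
      rintro u ⟨hu1, hu2⟩
      refine ⟨⟨c β, hc0 β, hcb β, hu1.nr.symm.mono (by omega)⟩, ?_⟩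
      exact ((hu2.mono h13 le_rfl).trans (h1 β)).mono le_rfl (by omega)
    have e3 : Conn G (Arm β) (y β) x := by
      refine (h1 β).conn_mem.mono ?_
      rintro u ⟨hu1, hu2⟩
      refine ⟨⟨c β, hc0 β, hcb β, (hu1.nr.symm.trans (h2 β).nr).mono (by omega)⟩, ?_⟩
      exact hu2.mono le_rfl (by omega)
    exact (e1.trans e2).trans e3
  obtain ⟨a, b, d, hab, hbd, hle1, hle2⟩ := sort3 t
  have hcc : Conn G (Arm a ∪ Arm d) (f a 0) (f d 0) :=
    ((hconn a).mono Set.subset_union_left).trans ((hconn d).mono Set.subset_union_right).symm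
  obtain ⟨u, hu, hub⟩ := bag_cross hE hI hle1 hle2 (hft a 0) (hft d 0) hcc
  have huf : ∀ i, ¬ Nr G q u (f b i) := by
    intro i hn
    have key : ∀ β, β ≠ b → u ∈ Arm β → False := by
      rintro β hβ ⟨⟨w, hw, hwy, huw⟩, -⟩
      exact sep β b hβ w hw (f b i) (h3 b i).left hwy (hfb b _ (h3 b i))
        ((huw.symm.trans hn).mono (by omega))
    rcases hu with hu | hu
    · exact key a hab hu
    · exact key d hbd.symm hu
  refine ⟨t b, Fin.cons u (f b), ?_, ?_, ?_⟩
  · intro i; refine Fin.cases ?_ (fun i => ?_) i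
    · simpa using hub
    · simpa using hft b i
  · intro i; refine Fin.cases ?_ (fun i => ?_) i
    · simp only [Fin.cons_zero]
      exact hu.elim (fun h => h.2) (fun h => h.2)
    · simp only [Fin.cons_succ]
      exact (harm1 b _ (h3 b i)).2
  · intro i j
    refine Fin.cases ?_ (fun i => ?_) i <;> refine Fin.cases ?_ (fun j => ?_) j
    · simp
    · intro _; simpa using huf j
    · intro _ h; exact huf i (by simpa using h.symm)
    · intro h
      simpa using hfq b i j (fun h' => h (by rw [h']))

theorem phi {L : Type*} [LinearOrder L] {B : L → Set V} (hV : ∀ v, ∃ t, v ∈ B t)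
    (hE : ∀ u v : V, G.Adj u v → ∃ t, u ∈ B t ∧ v ∈ B t)
    (hI : ∀ t₁ t₂ t₃ : L, t₁ ≤ t₂ → t₂ ≤ t₃ → B t₁ ∩ B t₃ ⊆ B t₂)
    {p q r0 K : ℕ} (hD : ∀ i, ρ i ≤ D i) (hρ : ∀ i, i < 3 * p → 8 * ρ (i + 1) ≤ ρ i)
    (hDD : ∀ i, D i + K ≤ D (i + 1)) (hq : ∀ i, q ≤ ρ i) (hr0 : ∀ i, ρ i ≤ r0)
    (hK : 2 * (3 * r0 * p) + 4 * r0 ≤ K) :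
    ∀ m, m ≤ p → ∀ x, Nw G ρ D A (3 * m) x → ∃ (t : L) (f : Fin (m + 1) → V), (∀ i, f i ∈ B t) ∧
      (∀ i, NI G (Useq G ρ D A (3 * m)) (3 * r0 * m) (f i) x) ∧
      ∀ i j, i ≠ j → ¬ Nr G q (f i) (f j) := by
  intro m
  induction m with
  | zero =>
    intro _ x hx
    obtain ⟨t, ht⟩ := hV x
    refine ⟨t, fun _ => x, fun _ => ht, fun _ => NI.refl hx, fun i j hij => ?_⟩
    exact absurd (Subsingleton.elim (α := Fin 1) i j) hij
  | succ m ih =>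
    intro hm x hx
    have hbad : ∀ n, n < 3 * p → ∀ x y, Bad G ρ D A n x y → Nw G ρ D A n x := fun n hn x y h =>
      bad_nw hD (fun i hi => hρ i (by omega)) (fun i => by have := hDD i; have := hr0 i; omega) h
    set n := 3 * m with hn
    have e3 : 3 * (m + 1) = n + 3 := by omega
    rw [e3] at hx ⊢
    obtain ⟨x1, x2, a, b, hb12, hab, hx1, hx2⟩ := claim2 hx
    obtain ⟨y1, y2, a1, b1, hby, hab1, hy1, hy2⟩ := claim2 (hbad _ (by omega) _ _ hb12)
    obtain ⟨y3, y4, a3, b3, hby3, hab3, hy3, -⟩ := claim2 (hbad _ (by omega) _ _ hb12.symm)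
    let y : Fin 3 → V := ![y1, y2, y3]
    have hyN : ∀ β, Nw G ρ D A (n + 1) (y β) := by
      intro β
      fin_cases β
      · exact hbad _ (by omega) _ _ hby
      · exact hbad _ (by omega) _ _ hby.symm
      · exact hbad _ (by omega) _ _ hby3
    have hc : ∀ β, ∃ c, Nw G ρ D A n c ∧ NI G (Useq G ρ D A (n + 1)) (ρ n / 2) (y β) c := by
      intro β
      obtain ⟨c, c', hb, hc⟩ := claim2' (hyN β)
      exact ⟨c, hbad _ (by omega) _ _ hb, hc⟩
    choose c hcN hcy using hc
    have hP := fun β => ih (by omega) (c β) (hcN β)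
    choose t f hft hfc hfq using hP
    have hρn := hρ n (by omega)
    have hρn1 : 8 * ρ (n + 2) ≤ ρ (n + 1) := hρ (n + 1) (by omega)
    have hρn2 := hρ (n + 2) (by omega)
    have hqn := hq (n + 1)
    have hMp : 3 * r0 * m + 3 * r0 ≤ 3 * r0 * p := by
      have : 3 * r0 * (m + 1) ≤ 3 * r0 * p := Nat.mul_le_mul_left _ (by omega)
      linarith [this, mul_add (3 * r0) m 1]
    have hMm : 3 * r0 * (m + 1) = 3 * r0 * m + 3 * r0 := by ring
    have hr := hr0 n
    generalize 3 * r0 * m = Mm at *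
    generalize 3 * r0 * (m + 1) = Mm' at *
    generalize 3 * r0 * p = Mp at *
    have hDn := hDD n
    have hDn1 : D (n + 1) + K ≤ D (n + 2) := hDD (n + 1)
    have hs1 : ∀ β, NI G (Useq G ρ D A (n + 3)) (ρ (n + 1) + ρ (n + 2)) (y β) x := by
      intro β
      fin_cases β
      · exact ((hy1.symm.mono (Useq_mono (by omega)) le_rfl).trans hx1.symm).mono le_rfl (by omega)
      · exact ((hy2.symm.mono (Useq_mono (by omega)) le_rfl).trans hx1.symm).mono le_rfl (by omega)
      · exact ((hy3.symm.mono (Useq_mono (by omega)) le_rfl).trans hx2.symm).mono le_rfl (by omega)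
    have hsep0 : ∀ β β', (∃ w ∈ Useq G ρ D A n, ∃ w' ∈ Useq G ρ D A n,
        NI G (Useq G ρ D A (n + 1)) (Mm + ρ n) w (y β) ∧
        NI G (Useq G ρ D A (n + 1)) (Mm + ρ n) w' (y β') ∧ Nr G (ρ n) w w') →
        NI G (Useq G ρ D A (n + 1)) (D n + 2 * Mm + 2 * ρ n) (y β) (y β') := by
      rintro β β' ⟨w, hw, w', hw', h1, h2, h3⟩
      exact ((h1.symm.trans (claim1 (hD n) hw hw' h3)).trans h2).mono le_rfl (by omega)
    have s01 : ¬ NI G (Useq G ρ D A (n + 1)) (D n + 2 * Mm + 2 * ρ n) y1 y2 := by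
      intro h
      exact hby.2.2.2 (h.mono le_rfl (by omega))
    have sx : ∀ z a, a ≤ ρ (n + 1) → NI G (Useq G ρ D A (n + 2)) a x1 z →
        ¬ NI G (Useq G ρ D A (n + 1)) (D n + 2 * Mm + 2 * ρ n) z y3 := by
      intro z a ha hz h
      apply hb12.2.2.2
      exact ((hz.trans (h.mono (Useq_succ _) le_rfl)).trans hy3.symm).mono le_rfl (by omega)
    have hsep : ∀ β β', β ≠ β' →
        ¬ NI G (Useq G ρ D A (n + 1)) (D n + 2 * Mm + 2 * ρ n) (y β) (y β') := by
      intro β β' hne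
      have s02 := sx y1 a1 (by omega) hy1
      have s12 := sx y2 b1 (by omega) hy2
      fin_cases β <;> fin_cases β' <;>
        first
        | exact absurd rfl hne
        | exact s01
        | exact s02
        | exact s12
        | exact fun h => s01 h.symm
        | exact fun h => s02 h.symm
        | exact fun h => s12 h.symm
    exact phi_step hE hI (Useq_succ n) (Useq_mono (by omega)) (r := ρ n) (q := q) (M := Mm)
      (s := ρ (n + 1) + ρ (n + 2)) (by omega) (by omega) (by omega) x y c t f hft hfq hs1 hcy hfc
      (fun β β' hne w hw w' hw' h1 h2 h3 => hsep β β' hne (hsep0 β β' ⟨w, hw, w', hw', h1, h2, h3⟩))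

end

theorem lemmaU (p q r : ℕ) (hp : 1 ≤ p) : ∃ R D : ℕ, ∀ (V : Type) (G : SimpleGraph V),
    HasPQPathDecomp G p q → ∀ A : Set V, ∃ U : Set V, A ⊆ U ∧ (∀ u ∈ U, ∃ a ∈ A, NI G U R u a) ∧
      ∀ x ∈ U, ∀ y ∈ U, Nr G r x y → NI G U D x y := by
  classical
  set ρ : ℕ → ℕ := fun n => 8 ^ (3 * p - n) * (r + q + 1) with hρdef
  set r0 := ρ 0 with hr0def
  set K := 2 * (3 * r0 * p) + 4 * r0 with hK
  set D : ℕ → ℕ := fun n => (n + 1) * K with hDdef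
  have hρ : ∀ i, i < 3 * p → 8 * ρ (i + 1) ≤ ρ i := by
    intro i hi
    simp only [hρdef]
    have : 3 * p - i = (3 * p - (i + 1)) + 1 := by omega
    rw [this, pow_succ]
    apply le_of_eq; ring
  have hr0 : ∀ i, ρ i ≤ r0 := by
    intro i
    simp only [hr0def, hρdef]
    exact Nat.mul_le_mul_right _ (Nat.pow_le_pow_right (by norm_num) (by omega))
  have hlow : ∀ i, r + q + 1 ≤ ρ i := by
    intro i
    simp only [hρdef]
    exact Nat.le_mul_of_pos_left _ (by positivity)
  have hDD : ∀ i, D i + K ≤ D (i + 1) := by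
    intro i; simp only [hDdef]; apply le_of_eq; ring
  have hDK : ∀ i, K ≤ D i := fun i => by
    simp only [hDdef]; exact Nat.le_mul_of_pos_left _ (by omega)
  have hD : ∀ i, ρ i ≤ D i := fun i => by have := hr0 i; have := hDK i; omega
  refine ⟨3 * p * r0, D (3 * p - 1), ?_⟩
  rintro V G ⟨L, ord, B, hV, hE, hI, hB⟩ A
  have hphi := phi (G := G) (A := A) hV hE hI (p := p) (q := q) (r0 := r0) (K := K) hD hρ hDD
    (fun i => by have := hlow i; omega) hr0 le_rfl p le_rfl
  have hemp : ∀ x, ¬ Nw G ρ D A (3 * p) x := by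
    intro x hx
    obtain ⟨t, f, hft, -, hfq⟩ := hphi x hx
    obtain ⟨𝒜, hcard, hBt, hdiam⟩ := hB t
    have : ∀ i, ∃ S ∈ 𝒜, f i ∈ S := by
      intro i
      have := hft i
      rw [hBt] at this
      simpa using this
    choose S hS hfS using this
    obtain ⟨i, -, j, -, hij, hSij⟩ := Finset.exists_ne_map_eq_of_card_lt_of_maps_to
      (s := (Finset.univ : Finset (Fin (p + 1)))) (t := 𝒜) (by simp; omega) (f := S)
      (fun i _ => hS i)
    exact hfq i j hij (eSetDist_le_iff.1 (hdiam _ (hS i) _ (hfS i) _ (hSij ▸ hfS j)))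
  obtain ⟨n, hn⟩ : ∃ n, 3 * p = n + 1 := ⟨3 * p - 1, by omega⟩
  have hn' : 3 * p - 1 = n := by omega
  rw [hn']
  rw [hn] at hemp
  refine ⟨Useq G ρ D A n, Useq_mono (m := 0) (by omega), ?_, ?_⟩
  · have : ∀ i, ∀ u ∈ Useq G ρ D A i, ∃ a ∈ A, NI G (Useq G ρ D A i) (i * r0) u a := by
      intro i
      induction i with
      | zero => intro u hu; exact ⟨u, hu, NI.refl hu⟩
      | succ i ih =>
        intro u hu
        by_cases hu' : u ∈ Useq G ρ D A i
        · obtain ⟨a, ha, h⟩ := ih u hu'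
          exact ⟨a, ha, h.mono (Useq_succ i) (Nat.mul_le_mul_right _ (by omega))⟩
        · obtain ⟨x, y, hb, hx⟩ := claim2' (G := G) ⟨hu, hu'⟩
          obtain ⟨a, ha, h⟩ := ih x hb.1
          refine ⟨a, ha, (hx.trans (h.mono (Useq_succ i) le_rfl)).mono le_rfl ?_⟩
          have := hr0 i
          have : (i + 1) * r0 = i * r0 + r0 := by ring
          omega
    intro u hu
    obtain ⟨a, ha, h⟩ := this n u hu
    exact ⟨a, ha, h.mono le_rfl (Nat.mul_le_mul_right _ (by omega))⟩
  · intro x hx y hy h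
    by_contra hni
    have hrn : Nr G (ρ n) x y := h.mono (by have := hlow n; omega)
    obtain ⟨w, hw⟩ := hrn
    apply hni
    refine ⟨w, hw.trans (hD n), fun v hv => ?_⟩
    by_contra hvn
    exact hemp v ⟨Or.inr ⟨x, y, w, hx, hy, hw, hni, hv⟩, hvn⟩
end CM
open SimpleGraph
namespace CM

theorem fat_menger {V W : Type*} [Finite W] {G : SimpleGraph V} (H : SimpleGraph W)
    (A : W → Set V) (E : W → W → Set V) (S T : Set V) (SA TB : Set W) (c k : ℕ)
    (hA : ∀ w, ∀ a ∈ A w, ∀ b ∈ A w, Conn G (A w) a b)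
    (hE : ∀ w w', H.Adj w w' → ∃ a ∈ A w, ∃ b ∈ A w', Conn G (A w ∪ E w w' ∪ A w') a b)
    (F1 : ∀ w w', w ≠ w' → Far G c (A w) (A w'))
    (F2 : ∀ w w' x, H.Adj w w' → x ≠ w → x ≠ w' → Far G c (E w w') (A x))
    (F3 : ∀ w w' x x', H.Adj w w' → H.Adj x x' → w ≠ x → w ≠ x' → w' ≠ x → w' ≠ x' →
      Far G c (E w w') (E x x'))
    (hSA : ∀ w ∈ SA, ∃ s ∈ S, s ∈ A w) (hTB : ∀ w ∈ TB, ∃ s ∈ T, s ∈ A w)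
    (hsep : ∀ X : Finset W, X.card ≤ k → ∃ Z, ST H SA TB Z ∧ Disjoint Z (X : Set W)) :
    ∃ Z : Fin (k + 1) → Set V, (∀ i, ST G S T (Z i)) ∧ ∀ i j, i ≠ j → Far G c (Z i) (Z j) := by
  obtain ⟨Y, hY, hd⟩ := menger H SA TB k hsep
  set Z : Set W → Set V := fun Y => {v | (∃ w ∈ Y, v ∈ A w) ∨
    ∃ w ∈ Y, ∃ w' ∈ Y, H.Adj w w' ∧ v ∈ E w w'} with hZ
  have hconn : ∀ (Y : Set W) (w w' : W), Conn H Y w w' → ∀ a ∈ A w, ∀ b ∈ A w', Conn G (Z Y) a b := by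
    rintro Y w w' ⟨p, hp⟩
    induction p with
    | nil =>
      intro a ha b hb
      exact (hA _ a ha b hb).mono (fun v hv => Or.inl ⟨_, hp _ (by simp), hv⟩)
    | @cons w x y h p ih =>
      have hw : w ∈ Y := hp w (by simp)
      have hp' : ∀ v ∈ p.support, v ∈ Y := fun v hv => hp v (by simp [hv])
      have hx : x ∈ Y := hp' _ p.start_mem_support
      intro a ha b hb
      obtain ⟨a', ha', x', hx', hc⟩ := hE w x h
      refine ((hA w a ha a' ha').mono (fun v hv => Or.inl ⟨w, hw, hv⟩)).trans
        ((hc.mono ?_).trans (ih hp' x' hx' b hb))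
      rintro v ((hv | hv) | hv)
      · exact Or.inl ⟨w, hw, hv⟩
      · exact Or.inr ⟨w, hw, x, hx, h, hv⟩
      · exact Or.inl ⟨x, hx, hv⟩
  refine ⟨fun i => Z (Y i), fun i => ?_, fun i j hij => ?_⟩
  · obtain ⟨w, hw, w', hw', hc⟩ := hY i
    obtain ⟨s, hs, hs'⟩ := hSA w hw
    obtain ⟨t, ht, ht'⟩ := hTB w' hw'
    exact ⟨s, hs, t, ht, hconn _ _ _ hc s hs' t ht'⟩
  · have hne : ∀ w ∈ Y i, ∀ w' ∈ Y j, w ≠ w' := by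
      rintro w hw w' hw' rfl
      exact Set.disjoint_left.1 (hd i j hij) hw hw'
    rintro a (⟨w, hw, ha⟩ | ⟨w, hw, w', hw', h, ha⟩) b (⟨x, hx, hb⟩ | ⟨x, hx, x', hx', h', hb⟩)
    · exact F1 w x (hne w hw x hx) a ha b hb
    · exact (F2 x x' w h' (hne w hw x hx) (hne w hw x' hx')).symm a ha b hb
    · exact F2 w w' x h (hne w hw x hx).symm (hne w' hw' x hx).symm a ha b hb
    · exact F3 w w' x x' h h' (hne _ hw _ hx) (hne _ hw _ hx') (hne _ hw' _ hx) (hne _ hw' _ hx') a ha b hb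

/-- pigeonhole: each obstruction kills at most one index -/
theorem pigeon {Θ : Type*} [Fintype Θ] (bad : Θ → ℕ → Prop)
    (h : ∀ θ i j, bad θ i → bad θ j → i = j) : ∃ i, i ≤ Fintype.card Θ ∧ ∀ θ, ¬ bad θ i := by
  by_contra hcon
  push Not at hcon
  choose f hf using fun i : Fin (Fintype.card Θ + 1) => hcon i (by omega)
  have : Function.Injective f := by
    intro i j hij
    have h1 := hf i
    rw [hij] at h1
    exact Fin.ext (h _ _ _ h1 (hf j))
  have := Fintype.card_le_of_injective f this
  simp at this
end CM
open SimpleGraph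
namespace CM

theorem walk_getVert_NI {V : Type*} {G : SimpleGraph V} {x y : V} (w : G.Walk x y) {U : Set V}
    (hU : ∀ v ∈ w.support, v ∈ U) (a : ℕ) (ha : a ≤ w.length) :
    NI G U a x (w.getVert a) ∧ NI G U (w.length - a) (w.getVert a) y := by
  refine ⟨⟨w.take a, ?_, ?_⟩, ⟨w.drop a, ?_, ?_⟩⟩
  · rw [Walk.take_length]; omega
  · intro v hv; exact hU v ((w.isSubwalk_take a).support_subset hv)
  · rw [Walk.drop_length]
  · intro v hv; exact hU v ((w.isSubwalk_drop a).support_subset hv)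

/-- one row -/
theorem row {V : Type*} {G : SimpleGraph V} {U S T : Set V} {r s D' : ℕ}
    (hcl : ∀ x ∈ U, ∀ y ∈ U, Nr G (r + 2 * s) x y → NI G U D' x y) (hST : ST G S T U) :
    ∃ (n : ℕ) (P : ℕ → V), P 0 ∈ S ∧ P n ∈ T ∧ (∀ a < n, G.Adj (P a) (P (a + 1))) ∧
      (∀ a ≤ n, ∃ u ∈ U, Nr G (3 * s) u (P a)) ∧
      (∀ a ≤ n, ∀ b ≤ n, Nr G r (P a) (P b) → b ≤ a + (D' + 8 * s)) ∧
      (∀ x ∈ S, ∀ b ≤ n, Nr G s x (P b) → b ≤ 6 * s) ∧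
      (∀ x ∈ T, ∀ b ≤ n, Nr G s x (P b) → n ≤ b + 6 * s) := by
  classical
  by_cases hnear : ∃ u ∈ U, ∃ x ∈ S, ∃ y ∈ T, Nr G (3 * s) x u ∧ Nr G (3 * s) u y
  · obtain ⟨u, hu, x, hx, y, hy, ⟨w1, h1⟩, ⟨w2, h2⟩⟩ := hnear
    have hlen : (w1.append w2).length ≤ 6 * s := by rw [Walk.length_append]; omega
    refine ⟨(w1.append w2).length, (w1.append w2).getVert, by simpa using hx,
      by rw [Walk.getVert_length]; exact hy,
      fun a ha => Walk.adj_getVert_succ _ ha, ?_, ?_, ?_, ?_⟩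
    · intro a ha
      refine ⟨u, hu, ?_⟩
      have : (w1.append w2).getVert a ∈ (w1.append w2).support := Walk.getVert_mem_support _ _
      rw [Walk.mem_support_append_iff] at this
      rcases this with h | h
      · obtain ⟨p1, p2, h0, -, -⟩ := walk_split w1 h
        exact Nr.symm ⟨p2, by omega⟩
      · obtain ⟨p1, p2, h0, -, -⟩ := walk_split w2 h
        exact ⟨p1, by omega⟩
    · intro a _ b _ _; omega
    · intro _ _ b _ _; omega
    · intro _ _ b _ _; omega
  · push Not at hnear
    set Q : ℕ → Prop := fun n => ∃ u v, (∃ x ∈ S, Nr G s x u) ∧ (∃ y ∈ T, Nr G s v y) ∧ NI G U n u v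
      with hQ
    have hex : ∃ n, Q n := by
      obtain ⟨x, hx, y, hy, hc⟩ := hST
      obtain ⟨n, hn⟩ := hc.ni
      exact ⟨n, x, y, ⟨x, hx, Nr.refl⟩, ⟨y, hy, Nr.refl⟩, hn⟩
    obtain ⟨u, v, ⟨x, hx, w1, hw1⟩, ⟨y, hy, w2, hw2⟩, w, hwl, hwU⟩ := Nat.find_spec hex
    have hmin : ∀ n, Q n → w.length ≤ n := fun n hn => hwl.trans (Nat.find_min' hex hn)
    have hNI := walk_getVert_NI w hwU
    have hu : u ∈ U := hwU _ w.start_mem_support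
    have hv : v ∈ U := hwU _ w.end_mem_support
    have mS : ∀ a ≤ w.length, ∀ x ∈ S, Nr G s x (w.getVert a) → a = 0 := by
      intro a ha x hx h
      have := hmin (w.length - a) ⟨_, v, ⟨x, hx, h⟩, ⟨y, hy, w2, hw2⟩, (hNI a ha).2⟩
      by_contra h0
      have h00 : a = w.length ∨ a < w.length := by omega
      omega
    have mT : ∀ a ≤ w.length, ∀ x ∈ T, Nr G s x (w.getVert a) → a = w.length := by
      intro a ha z hz h
      have := hmin a ⟨u, _, ⟨x, hx, w1, hw1⟩, ⟨z, hz, h.symm⟩, (hNI a ha).1⟩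
      omega
    have mU : ∀ a ≤ w.length, ∀ b ≤ w.length, NI G U D' (w.getVert a) (w.getVert b) → b ≤ a + D' := by
      intro a ha b hb h
      have := hmin (a + D' + (w.length - b)) ⟨u, v, ⟨x, hx, w1, hw1⟩, ⟨y, hy, w2, hw2⟩,
        ((hNI a ha).1.trans h).trans (hNI b hb).2⟩
      omega
    set Wk := (w1.append w).append w2 with hWk
    have hlen : Wk.length = w1.length + w.length + w2.length := by
      simp [hWk, Walk.length_append]
    have tri : ∀ b ≤ Wk.length, (b ≤ s ∧ Nr G s u (Wk.getVert b)) ∨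
        (∃ a ≤ w.length, Wk.getVert b = w.getVert a ∧ b = w1.length + a) ∨
        ((Wk.length ≤ b + s ∧ w.length ≤ b) ∧ Nr G s v (Wk.getVert b)) := by
      intro b hb
      have hg : Wk.getVert b = _ := Walk.getVert_append _ _ b
      rw [Walk.length_append] at hg
      have hg1 : (w1.append w).getVert b = _ := Walk.getVert_append _ _ b
      by_cases h1 : b < w1.length
      · left
        rw [if_pos (by omega), hg1, if_pos h1] at hg
        refine ⟨by omega, ?_⟩
        rw [hg]
        have := (walk_getVert_NI w1 (U := Set.univ) (by simp) b (by omega)).2.nr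
        exact (this.mono (by omega)).symm
      by_cases h2 : b < w1.length + w.length
      · right; left
        rw [if_pos h2, hg1, if_neg h1] at hg
        exact ⟨b - w1.length, by omega, hg, by omega⟩
      · right; right
        rw [if_neg h2] at hg
        refine ⟨by omega, ?_⟩
        rw [hg]
        have := (walk_getVert_NI w2 (U := Set.univ) (by simp) (b - (w1.length + w.length)) (by omega)).1.nr
        exact this.mono (by omega)
    have shadow : ∀ b ≤ Wk.length, ∃ a ≤ w.length, Nr G s (Wk.getVert b) (w.getVert a) ∧
        b ≤ a + 2 * s ∧ a ≤ b := by
      intro b hb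
      rcases tri b hb with ⟨h1, h2⟩ | ⟨a, h1, h2, h3⟩ | ⟨h1, h2⟩
      · exact ⟨0, by omega, by simpa using h2.symm, by omega, by omega⟩
      · exact ⟨a, h1, by rw [h2]; exact Nr.refl, by omega, by omega⟩
      · exact ⟨w.length, le_rfl, by simpa using h2.symm, by omega, by omega⟩
    refine ⟨Wk.length, Wk.getVert, by simpa using hx,
      by rw [Walk.getVert_length]; exact hy,
      fun a ha => Walk.adj_getVert_succ _ ha, ?_, ?_, ?_, ?_⟩
    · intro a ha
      rcases tri a ha with ⟨-, h2⟩ | ⟨a', h1, h2, h3⟩ | ⟨-, h2⟩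
      · exact ⟨u, hu, h2.mono (by omega)⟩
      · exact ⟨w.getVert a', (hNI a' h1).1.right, by rw [h2]; exact Nr.refl⟩
      · exact ⟨v, hv, h2.mono (by omega)⟩
    · intro a ha b hb h
      obtain ⟨a', ha', h1, h2, h3⟩ := shadow a ha
      obtain ⟨b', hb', h1', h2', h3'⟩ := shadow b hb
      have := mU a' ha' b' hb' (hcl _ (hNI a' ha').1.right _ (hNI b' hb').1.right
        (((h1.symm.trans h).trans h1').mono (by omega)))
      omega
    · intro z hz b hb h
      rcases tri b hb with ⟨h1, h2⟩ | ⟨a', h1, h2, h3⟩ | ⟨-, h2⟩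
      · omega
      · rw [h2] at h
        have := mS a' h1 z hz h
        omega
      · exact absurd (Nr.mono (by omega) ⟨w2, hw2⟩) (hnear v hv z hz y hy ((h.trans h2.symm).mono (by omega)))
    · intro z hz b hb h
      rcases tri b hb with ⟨h1, h2⟩ | ⟨a', h1, h2, h3⟩ | ⟨h1, h2⟩
      · exact absurd ((h2.trans h.symm).mono (by omega)) (hnear u hu x hx z hz (Nr.mono (by omega) ⟨w1, hw1⟩))
      · rw [h2] at h
        have := mT a' h1 z hz h
        omega
      · omega
end CM
open SimpleGraph
namespace CM

structure Rows {V : Type*} (G : SimpleGraph V) (S T : Set V) (k r s D D1 : ℕ) where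
  n : Fin k → ℕ
  P : Fin k → ℕ → V
  hS : ∀ i, P i 0 ∈ S
  hT : ∀ i, P i (n i) ∈ T
  adj : ∀ i, ∀ a < n i, G.Adj (P i a) (P i (a + 1))
  F : ∀ i j a b, a ≤ n i → b ≤ n j → Nr G r (P i a) (P j b) → i = j ∧ b ≤ a + D ∧ a ≤ b + D
  Sc : ∀ x ∈ S, ∀ i b, b ≤ n i → Nr G s x (P i b) → b ≤ D1
  Tc : ∀ x ∈ T, ∀ i b, b ≤ n i → Nr G s x (P i b) → n i ≤ b + D1

section
variable {V : Type*} {G : SimpleGraph V} {S T : Set V} {k r s D D1 : ℕ}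

theorem Rows.NI_sub (R : Rows G S T k r s D D1) (i : Fin k) {a b : ℕ} (hab : a ≤ b) (hb : b ≤ R.n i) :
    NI G (R.P i '' Set.Icc a b) (b - a) (R.P i a) (R.P i b) := by
  induction b, hab using Nat.le_induction with
  | base => exact NI.refl ⟨a, by simp, rfl⟩
  | succ b hab ih =>
    have h1 := (ih (by omega)).mono (Set.image_mono (Set.Icc_subset_Icc_right (Nat.le_succ b))) le_rfl
    have hadj := R.adj i b (by omega)
    have h2 : NI G (R.P i '' Set.Icc a (b + 1)) 1 (R.P i b) (R.P i (b + 1)) := by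
      refine ⟨hadj.toWalk, by simp, ?_⟩
      intro v hv
      simp only [Walk.support_cons, Walk.support_nil, List.mem_cons, List.not_mem_nil, or_false] at hv
      rcases hv with rfl | rfl
      · exact ⟨b, ⟨hab, by omega⟩, rfl⟩
      · exact ⟨b + 1, ⟨by omega, le_rfl⟩, rfl⟩
    exact (h1.trans h2).mono le_rfl (by omega)

structure IsJump (R : Rows G S T k r s D D1) (η : ℕ) (σ : Option (Fin k)) (z : ℕ)
    (τ : Option (Fin k)) (y : ℕ) (w0 w1 : V) (Q : Set V) : Prop where
  conn : ∀ g ∈ Q, Conn G Q w0 g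
  m0 : w0 ∈ Q
  m1 : w1 ∈ Q
  s0 : σ = none → w0 ∈ S ∧ z = 0
  s1 : ∀ i, σ = some i → z ≤ R.n i ∧ Nr G η w0 (R.P i z)
  t0 : τ = none → w1 ∈ T ∧ y = 0
  t1 : ∀ i, τ = some i → y ≤ R.n i ∧ Nr G η w1 (R.P i y)
  jp : ∀ g ∈ Q, ∀ m ≤ s, ∀ i a, a ≤ R.n i → Nr G m g (R.P i a) → η ≤ m ∧
    ((σ = some i ∧ a ≤ z + D ∧ z ≤ a + D ∧ Nr G (m - η) g w0) ∨
     (τ = some i ∧ a ≤ y + D ∧ y ≤ a + D ∧ Nr G (m - η) g w1))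

theorem side (R : Rows G S T k r s D D1) {η : ℕ} (hη : η ≤ s) (h3 : 3 * s ≤ r) (S0 : Set V)
    (LL : Fin k → ℕ → Prop) (u : V)
    (h : (∃ i a, a ≤ R.n i ∧ LL i a ∧ Nr G s u (R.P i a) ∧
        ∀ j b m, b ≤ R.n j → Nr G m u (R.P j b) → s ≤ m) ∨
      (u ∈ S0 ∧ ∀ j b, b ≤ R.n j → ¬ Nr G s u (R.P j b))) :
    ∃ (σ : Option (Fin k)) (z : ℕ) (w0 : V) (X : Set V), w0 ∈ X ∧ u ∈ X ∧ (∀ g ∈ X, Conn G X u g) ∧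
      (σ = none → w0 ∈ S0 ∧ z = 0) ∧ (∀ i, σ = some i → (z ≤ R.n i ∧ Nr G η w0 (R.P i z)) ∧ LL i z) ∧
      ∀ g ∈ X, ∀ m ≤ s, ∀ i a, a ≤ R.n i → Nr G m g (R.P i a) → η ≤ m ∧
        σ = some i ∧ a ≤ z + D ∧ z ≤ a + D ∧ Nr G (m - η) g w0 := by
  rcases h with ⟨i, a, ha, hLL, hn, hfar⟩ | ⟨hu, hfar⟩
  · obtain ⟨w0, ⟨p, hp⟩, h2⟩ := Nr.split_num (m := s - η) (n := η) (hn.mono (by omega))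
    refine ⟨some i, a, w0, {v | v ∈ p.support}, p.end_mem_support, p.start_mem_support, ?_, by simp,
      ?_, ?_⟩
    · intro g hg
      obtain ⟨p1, p2, -, h1, -⟩ := walk_split p hg
      exact ⟨p1, h1⟩
    · rintro j hj
      obtain rfl : i = j := by simpa using hj
      exact ⟨⟨ha, h2⟩, hLL⟩
    · intro g hg m hm j b hb hgb
      obtain ⟨p1, p2, hl, -, -⟩ := walk_split p hg
      have e1 : Nr G (p1.length + m) u (R.P j b) := Nr.trans ⟨p1, le_rfl⟩ hgb
      have e2 := hfar j b _ hb e1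
      obtain ⟨rfl, e4, e5⟩ := R.F i j a b ha hb ((hn.symm.trans e1).mono (by omega))
      exact ⟨by omega, rfl, e4, e5, p2, by omega⟩
  · refine ⟨none, 0, u, {u}, rfl, rfl, ?_, fun _ => ⟨hu, rfl⟩, by simp, ?_⟩
    · rintro g rfl; exact Conn.refl rfl
    · rintro g rfl m hm j b hb hgb
      exact absurd (hgb.mono hm) (hfar j b hb)

theorem extract (R : Rows G S T k r s D D1) {η E : ℕ} (hη : η ≤ s) (h3 : 3 * s ≤ r)
    (hE1 : D1 < E) (hE2 : D < 2 * E) (ξ : Fin k → ℕ) (hξ : ∀ i, ξ i ≤ R.n i) (Z : Set V)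
    (hZ : ST G S T Z) (hav : ∀ v ∈ Z, ∀ i, ¬ Nr G (E + s) v (R.P i (ξ i))) :
    ∃ σ z τ y w0 w1 Q, IsJump R η σ z τ y w0 w1 Q ∧ (∀ i, σ = some i → z + E ≤ ξ i) ∧
      (∀ i, τ = some i → ξ i + E ≤ y) := by
  classical
  set L : V → Prop := fun v => ∃ i a, a ≤ R.n i ∧ a + E ≤ ξ i ∧ Nr G s v (R.P i a) with hL
  set M : V → Prop := fun v => ∃ i a, a ≤ R.n i ∧ ξ i + E ≤ a ∧ Nr G s v (R.P i a) with hM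
  have hpos : ∀ v ∈ Z, ∀ i a, a ≤ R.n i → Nr G s v (R.P i a) → a + E ≤ ξ i ∨ ξ i + E ≤ a := by
    intro v hv i a ha hn
    by_contra hcon
    push Not at hcon
    apply hav v hv i
    rcases le_total a (ξ i) with h | h
    · exact (hn.trans (R.NI_sub i h (hξ i)).nr).mono (by omega)
    · exact (hn.trans (R.NI_sub i h ha).nr.symm).mono (by omega)
  have hLM : ∀ v, L v → M v → False := by
    rintro v ⟨i, a, ha, h1, h2⟩ ⟨j, b, hb, h1', h2'⟩
    obtain ⟨rfl, h4, h5⟩ := R.F i j a b ha hb ((h2.symm.trans h2').mono (by omega))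
    omega
  have hSM : ∀ v ∈ S, M v → False := by
    rintro v hv ⟨j, b, hb, h1', h2'⟩
    have := R.Sc v hv j b hb h2'
    omega
  have hTL : ∀ v ∈ T, L v → False := by
    rintro v hv ⟨j, b, hb, h1', h2'⟩
    have := R.Tc v hv j b hb h2'
    have := hξ j
    omega
  set Qn : ℕ → Prop := fun n => ∃ u v, (u ∈ S ∨ L u) ∧ (v ∈ T ∨ M v) ∧ NI G Z n u v with hQn
  have hex : ∃ n, Qn n := by
    obtain ⟨x, hx, y, hy, hc⟩ := hZ
    obtain ⟨n, hn⟩ := hc.ni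
    exact ⟨n, x, y, Or.inl hx, Or.inl hy, hn⟩
  obtain ⟨u, v, hu, hv, w, hwl, hwZ⟩ := Nat.find_spec hex
  have hmin : ∀ n, Qn n → w.length ≤ n := fun n hn => hwl.trans (Nat.find_min' hex hn)
  have hNI := walk_getVert_NI w hwZ
  have hSL : ∀ a ≤ w.length, (w.getVert a ∈ S ∨ L (w.getVert a)) → a = 0 := by
    intro a ha h
    have := hmin _ ⟨_, v, h, hv, (hNI a ha).2⟩
    omega
  have hTM : ∀ a ≤ w.length, (w.getVert a ∈ T ∨ M (w.getVert a)) → a = w.length := by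
    intro a ha h
    have := hmin _ ⟨u, _, hu, h, (hNI a ha).1⟩
    omega
  have huZ := hwZ u w.start_mem_support
  have hvZ := hwZ v w.end_mem_support
  -- u side
  have hU := side R hη h3 S (fun i a => a + E ≤ ξ i) u (by
    by_cases hLu : L u
    · left
      obtain ⟨i, a, ha, h1, h2⟩ := id hLu
      refine ⟨i, a, ha, h1, h2, ?_⟩
      intro j b m hb hm
      by_contra hlt
      push Not at hlt
      by_cases h0 : w.length = 0
      · have : u = v := Walk.eq_of_length_eq_zero h0
        subst this
        rcases hv with hv | hv
        · exact hTL _ hv hLu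
        · exact hLM _ hLu hv
      · have hadj := w.adj_getVert_succ (i := 0) (by omega)
        rw [Walk.getVert_zero, zero_add] at hadj
        have hn1 : Nr G s (w.getVert 1) (R.P j b) :=
          ((Nr.adj hadj.symm).trans hm).mono (by omega)
        rcases hpos _ (hNI 1 (by omega)).1.right j b hb hn1 with h | h
        · have := hSL 1 (by omega) (Or.inr ⟨j, b, hb, h, hn1⟩)
          omega
        · exact hLM u hLu ⟨j, b, hb, h, hm.mono (by omega)⟩
    · right
      have huS := hu.resolve_right hLu
      refine ⟨huS, fun j b hb hn => ?_⟩
      rcases hpos u huZ j b hb hn with h | h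
      · exact hLu ⟨j, b, hb, h, hn⟩
      · exact hSM u huS ⟨j, b, hb, h, hn⟩)
  have hVs := side R hη h3 T (fun i a => ξ i + E ≤ a) v (by
    by_cases hMv : M v
    · left
      obtain ⟨i, a, ha, h1, h2⟩ := id hMv
      refine ⟨i, a, ha, h1, h2, ?_⟩
      intro j b m hb hm
      by_contra hlt
      push Not at hlt
      by_cases h0 : w.length = 0
      · have : u = v := Walk.eq_of_length_eq_zero h0
        subst this
        rcases hu with hu | hu
        · exact hSM _ hu hMv
        · exact hLM _ hu hMv
      · have hadj := w.adj_getVert_succ (i := w.length - 1) (by omega)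
        rw [Nat.sub_add_cancel (by omega), Walk.getVert_length] at hadj
        have hn1 : Nr G s (w.getVert (w.length - 1)) (R.P j b) :=
          ((Nr.adj hadj).trans hm).mono (by omega)
        rcases hpos _ (hNI (w.length - 1) (by omega)).1.right j b hb hn1 with h | h
        · exact hLM v ⟨j, b, hb, h, hm.mono (by omega)⟩ hMv
        · have := hTM (w.length - 1) (by omega) (Or.inr ⟨j, b, hb, h, hn1⟩)
          omega
    · right
      have hvT := hv.resolve_right hMv
      refine ⟨hvT, fun j b hb hn => ?_⟩
      rcases hpos v hvZ j b hb hn with h | h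
      · exact hTL v hvT ⟨j, b, hb, h, hn⟩
      · exact hMv ⟨j, b, hb, h, hn⟩)
  obtain ⟨σ, z, w0, X, hw0, huX, hXc, hσ0, hσ1, hXj⟩ := hU
  obtain ⟨τ, y, w1, Y, hw1, hvY, hYc, hτ0, hτ1, hYj⟩ := hVs
  have hQc : ∀ g ∈ X ∪ {g | g ∈ w.support} ∪ Y, Conn G (X ∪ {g | g ∈ w.support} ∪ Y) u g := by
    have hXs : X ⊆ X ∪ {g | g ∈ w.support} ∪ Y := fun g hg => Or.inl (Or.inl hg)
    have hYs : Y ⊆ X ∪ {g | g ∈ w.support} ∪ Y := fun g hg => Or.inr hg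
    have hws : {g | g ∈ w.support} ⊆ X ∪ {g | g ∈ w.support} ∪ Y := fun g hg => Or.inl (Or.inr hg)
    have huv : Conn G (X ∪ {g | g ∈ w.support} ∪ Y) u v := ⟨w, fun g hg => hws hg⟩
    rintro g ((hg | hg) | hg)
    · exact (hXc g hg).mono hXs
    · obtain ⟨p1, p2, -, h1, -⟩ := walk_split w hg
      exact ⟨p1, fun t ht => hws (h1 t ht)⟩
    · exact huv.trans ((hYc g hg).mono hYs)
  refine ⟨σ, z, τ, y, w0, w1, X ∪ {g | g ∈ w.support} ∪ Y, ⟨?_, Or.inl (Or.inl hw0), Or.inr hw1,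
    hσ0, fun i hi => (hσ1 i hi).1, hτ0, fun i hi => (hτ1 i hi).1, ?_⟩, fun i hi => (hσ1 i hi).2,
    fun i hi => (hτ1 i hi).2⟩
  · intro g hg
    exact (hQc w0 (Or.inl (Or.inl hw0))).symm.trans (hQc g hg)
  · have hX' : ∀ g ∈ X, ∀ m ≤ s, ∀ i a, a ≤ R.n i → Nr G m g (R.P i a) → η ≤ m ∧
      ((σ = some i ∧ a ≤ z + D ∧ z ≤ a + D ∧ Nr G (m - η) g w0) ∨
      (τ = some i ∧ a ≤ y + D ∧ y ≤ a + D ∧ Nr G (m - η) g w1)) := by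
      intro g hg m hm i a ha hn
      obtain ⟨h1, h2⟩ := hXj g hg m hm i a ha hn
      exact ⟨h1, Or.inl h2⟩
    have hY' : ∀ g ∈ Y, ∀ m ≤ s, ∀ i a, a ≤ R.n i → Nr G m g (R.P i a) → η ≤ m ∧
      ((σ = some i ∧ a ≤ z + D ∧ z ≤ a + D ∧ Nr G (m - η) g w0) ∨
      (τ = some i ∧ a ≤ y + D ∧ y ≤ a + D ∧ Nr G (m - η) g w1)) := by
      intro g hg m hm i a ha hn
      obtain ⟨h1, h2⟩ := hYj g hg m hm i a ha hn
      exact ⟨h1, Or.inr h2⟩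
    rintro g ((hg | hg) | hg) m hm i a ha hn
    · exact hX' g hg m hm i a ha hn
    · obtain ⟨c, hc, hcl⟩ := Walk.mem_support_iff_exists_getVert.1 hg
      have hgs := hn.mono hm
      rcases hpos g (hwZ g hg) i a ha hgs with h | h
      · have := hSL c hcl (Or.inr (by rw [hc]; exact ⟨i, a, ha, h, hgs⟩))
        rw [this, Walk.getVert_zero] at hc
        exact hX' g (hc ▸ huX) m hm i a ha hn
      · have := hTM c hcl (Or.inr (by rw [hc]; exact ⟨i, a, ha, h, hgs⟩))
        rw [this, Walk.getVert_length] at hc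
        exact hY' g (hc ▸ hvY) m hm i a ha hn
    · exact hY' g hg m hm i a ha hn
end
end CM
open SimpleGraph
namespace CM

structure Asm {V : Type*} {G : SimpleGraph V} {S T : Set V} {k r s D D1 : ℕ}
    (R : Rows G S T k r s D D1) (J : Type) (η c Rc Km : ℕ) where
  B : Fin k → ℕ
  lo : Fin k → ℕ → ℕ
  hi : Fin k → ℕ → ℕ
  lo0 : ∀ i, lo i 0 = 0
  hiB : ∀ i, hi i (B i) = R.n i
  lohi : ∀ i m, m ≤ B i → lo i m ≤ hi i m
  hin : ∀ i m, m ≤ B i → hi i m ≤ R.n i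
  sep : ∀ i m m', m < m' → m' ≤ B i → hi i m + D < lo i m'
  Q : J → Set V
  row : J × Bool → Option (Fin k)
  pos : J × Bool → ℕ
  pt : J × Bool → V
  ix : J × Bool → ℕ
  Qc : ∀ j, ∀ g ∈ Q j, ∀ g' ∈ Q j, Conn G (Q j) g g'
  ptQ : ∀ l, pt l ∈ Q l.1
  near : ∀ l i, row l = some i → pos l ≤ R.n i ∧ Nr G η (pt l) (R.P i (pos l))
  jp : ∀ j, ∀ g ∈ Q j, ∀ m ≤ s, ∀ i a, a ≤ R.n i → Nr G m g (R.P i a) → η ≤ m ∧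
    ∃ b, row (j, b) = some i ∧ a ≤ pos (j, b) + D ∧ pos (j, b) ≤ a + D ∧ Nr G (m - η) g (pt (j, b))
  src : ∀ j, row (j, false) = none → pt (j, false) ∈ S
  tgt : ∀ j, row (j, true) = none → pt (j, true) ∈ T
  ixB : ∀ l i, row l = some i → ix l ≤ B i
  ixlo : ∀ l i, row l = some i → lo i (ix l) ≤ pos l
  ixhi : ∀ l i, row l = some i → pos l ≤ hi i (ix l)
  ixl : ∀ l i m, row l = some i → m < ix l → hi i m + D < pos l
  ixr : ∀ l i m, row l = some i → m ≤ B i → ix l < m → pos l + D < lo i m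
  κ : Fin k → ℕ → ℕ
  κ1 : ∀ i m, 2 * (c + Rc) ≤ κ i m
  κ2 : ∀ i m, κ i m ≤ Km
  κ3 : ∀ l l' i, row l = some i → row l' = some i → ix l = ix l' →
    Nr G (κ i (ix l) + 2 * (c + Rc)) (pt l) (pt l') → Nr G (κ i (ix l)) (pt l) (pt l')
  dom : ∀ m : Fin k → ℕ, (∀ i, m i ≤ B i) → ∃ j, (∀ i, row (j, false) = some i → ix (j, false) < m i) ∧
    (∀ i, row (j, true) = some i → m i < ix (j, true))

section
variable {V : Type*} {G : SimpleGraph V} {S T : Set V} {k r s D D1 : ℕ}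
  {R : Rows G S T k r s D D1} {J : Type} {η c Rc Km : ℕ}

theorem Asm.ix_eq (M : Asm R J η c Rc Km) {l l' i} (h : M.row l = some i) (h' : M.row l' = some i)
    (h1 : M.pos l ≤ M.pos l' + D) (h2 : M.pos l' ≤ M.pos l + D) : M.ix l = M.ix l' := by
  rcases lt_trichotomy (M.ix l) (M.ix l') with h3 | h3 | h3
  · have := M.ixl l' i _ h' h3
    have := M.ixhi l i h
    omega
  · exact h3
  · have := M.ixl l i _ h h3
    have := M.ixhi l' i h'
    omega

/-- the landing set with links -/
def Asm.AS (M : Asm R J η c Rc Km) : Set V :=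
  {g | (∃ j, g ∈ M.Q j) ∨ ∃ l l' i α β, M.row l = some i ∧ M.row l' = some i ∧ M.ix l = M.ix l' ∧
    α + β ≤ M.κ i (M.ix l) ∧ Nr G α g (M.pt l) ∧ Nr G β g (M.pt l')}

theorem Asm.link_seg (M : Asm R J η c Rc Km) {g l l' i α β} (h : M.row l = some i)
    (h' : M.row l' = some i) (hx : M.ix l = M.ix l') (hab : α + β ≤ M.κ i (M.ix l))
    (h1 : Nr G α g (M.pt l)) (h2 : Nr G β g (M.pt l')) : Conn G M.AS g (M.pt l) := by
  obtain ⟨w, hw⟩ := h1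
  refine ⟨w, fun v hv => Or.inr ?_⟩
  obtain ⟨w1, w2, hl, -, -⟩ := walk_split w hv
  exact ⟨l, l', i, w2.length, w1.length + β, h, h', hx, by omega, ⟨w2, le_rfl⟩,
    (Nr.symm ⟨w1, le_rfl⟩).trans h2⟩

theorem Asm.link (M : Asm R J η c Rc Km) {l l' i} (h : M.row l = some i)
    (h' : M.row l' = some i) (hx : M.ix l = M.ix l')
    (h1 : Nr G (M.κ i (M.ix l)) (M.pt l) (M.pt l')) : Conn G M.AS (M.pt l) (M.pt l') :=
  (M.link_seg h' h hx.symm (α := M.κ i (M.ix l)) (β := 0) (by rw [hx]; omega) h1 Nr.refl)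

theorem Asm.far_row (M : Asm R J η c Rc Km) (h1 : c + Rc + Km < η) (h2 : η ≤ s)
    {g : V} (hg : g ∈ M.AS) {i a} (ha : a ≤ R.n i) : ¬ Nr G (c + Rc) g (R.P i a) := by
  intro hn
  rcases hg with ⟨j, hj⟩ | ⟨l, l', i', α, β, hr, hr', hx, hab, hα, hβ⟩
  · have := (M.jp j g hj _ (by omega) i a ha hn).1
    omega
  · have h3 := M.κ2 i' (M.ix l)
    have := (M.jp l.1 _ (M.ptQ l) (α + (c + Rc)) (by omega) i a ha (hα.symm.trans hn)).1
    omega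

/-- a bit close to a component is attached to it -/
theorem Asm.bit (M : Asm R J η c Rc Km) (h2 : η + c + Rc + Km ≤ s) (h3 : 2 * s ≤ r)
    {U : Set V} (hU : M.AS ⊆ U) (hUR : ∀ u ∈ U, ∃ a ∈ M.AS, NI G U Rc u a)
    {l i α β u v} (hr : M.row l = some i) (hab : α + β ≤ η) (hα : Nr G α u (M.pt l))
    (hβ : Nr G β u (R.P i (M.pos l))) (hv : v ∈ U) (hn : Nr G c u v) : Conn G U v (M.pt l) := by
  obtain ⟨g, hg, hvg⟩ := hUR v hv
  have hln := M.near l i hr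
  have hQU : ∀ j, M.Q j ⊆ U := fun j x hx => hU (Or.inl ⟨j, hx⟩)
  have h1 := M.κ1 i (M.ix l)
  rcases hg with ⟨j, hj⟩ | ⟨l1, l2, i', α1, α2, hr1, hr2, hx, hab', hα1, hα2⟩
  · obtain ⟨e1, b, e2, e3, e4, e5⟩ := M.jp j g hj (Rc + c + β) (by omega) i (M.pos l) hln.1
      ((hvg.nr.symm.trans hn.symm).trans hβ)
    have hix := M.ix_eq hr e2 e3 e4
    have hl : Conn G M.AS (M.pt l) (M.pt (j, b)) := by
      apply M.link hr e2 hix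
      exact (((hα.symm.trans hn).trans hvg.nr).trans e5).mono (by omega)
    exact (hvg.conn.trans ((M.Qc j g hj _ (M.ptQ (j, b))).mono (hQU j))).trans (hl.mono hU).symm
  · have key : ∀ l1 l2 α1 α2, M.row l1 = some i' → M.row l2 = some i' → M.ix l1 = M.ix l2 →
        α1 + α2 ≤ M.κ i' (M.ix l1) → Nr G α1 g (M.pt l1) → Nr G α2 g (M.pt l2) → α1 ≤ α2 →
        Conn G U v (M.pt l) := by
      clear hr1 hr2 hx hab' hα1 hα2 l1 l2 α1 α2
      intro l1 l2 α1 α2 hr1 hr2 hx hab' hα1 hα2 hle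
      have hk2 := M.κ2 i' (M.ix l1)
      have en : Nr G (α1 + (Rc + c + β)) (M.pt l1) (R.P i (M.pos l)) :=
        hα1.symm.trans ((hvg.nr.symm.trans hn.symm).trans hβ)
      obtain ⟨e1, b, e2, e3, e4, e5⟩ := M.jp l1.1 _ (M.ptQ l1) _ (by omega) i (M.pos l) hln.1 en
      have hln1 := M.near l1 i' hr1
      obtain ⟨rfl, e6, e7⟩ := R.F i' i _ _ hln1.1 hln.1 ((hln1.2.symm.trans en).mono (by omega))
      have hix1 := M.ix_eq hr1 hr e7 e6
      have hix := M.ix_eq hr e2 e3 e4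
      have hl : Conn G M.AS (M.pt l) (M.pt (l1.1, b)) := by
        apply M.link hr e2 hix
        apply M.κ3 l _ i' hr e2 hix
        rw [hix1] at hab'
        exact (((hα.symm.trans hn).trans hvg.nr).trans (hα1.trans e5)).mono (by omega)
      have hseg := M.link_seg hr1 hr2 hx hab' hα1 hα2
      exact ((hvg.conn.trans (hseg.mono hU)).trans
        ((M.Qc l1.1 _ (M.ptQ l1) _ (M.ptQ (l1.1, b))).mono (hQU _))).trans (hl.mono hU).symm
    rcases le_total α1 α2 with h | h
    · exact key l1 l2 α1 α2 hr1 hr2 hx hab' hα1 hα2 h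
    · exact key l2 l1 α2 α1 hr2 hr1 hx.symm (by rw [← hx]; omega) hα2 hα1 h
end
end CM
open SimpleGraph
namespace CM

section
variable {V : Type*} {G : SimpleGraph V} {S T : Set V} {k r s D D1 : ℕ}
  {R : Rows G S T k r s D D1} {J : Type} {η c Rc Km : ℕ}

def cl (G : SimpleGraph V) (U : Set V) (v : V) : Set V := {y | Conn G U v y}

theorem cl_eq {U : Set V} {x y : V} (h : Conn G U x y) : cl G U x = cl G U y := by
  ext z
  exact ⟨fun hz => h.symm.trans hz, fun hz => h.trans hz⟩

theorem conn_of_cl {U : Set V} {x y : V} (hy : y ∈ U) (h : cl G U x = cl G U y) : Conn G U x y := by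
  have : y ∈ cl G U x := by rw [h]; exact Conn.refl hy
  exact this

abbrev WT (V : Type*) (k N : ℕ) := (Fin k × Fin (N + 1)) ⊕ Set V

def Asm.Aw (M : Asm R J η c Rc Km) (U : Set V) (N : ℕ) : WT V k N → Set V
  | .inl (i, m) => {v | m.1 ≤ M.B i ∧ ∃ a, M.lo i m ≤ a ∧ a ≤ M.hi i m ∧ v = R.P i a}
  | .inr C => {v | v ∈ U ∧ cl G U v = C}

def Asm.Ar (M : Asm R J η c Rc Km) (U : Set V) (N : ℕ) : WT V k N → WT V k N → Prop
  | .inl (i, m), .inl (i', m') => i = i' ∧ m'.1 = m.1 + 1 ∧ m'.1 ≤ M.B i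
  | .inr C, .inl (i, m) => ∃ l, M.row l = some i ∧ M.ix l = m.1 ∧ cl G U (M.pt l) = C
  | _, .inr _ => False

def Asm.Ed (M : Asm R J η c Rc Km) (U : Set V) (N : ℕ) : WT V k N → WT V k N → Set V
  | .inl (i, m), .inl (i', m') => {v | i = i' ∧ m'.1 = m.1 + 1 ∧ m'.1 ≤ M.B i ∧
      ∃ a, M.hi i m ≤ a ∧ a ≤ M.lo i m' ∧ v = R.P i a}
  | .inr C, .inl (i, m) => {v | ∃ l α β, M.row l = some i ∧ M.ix l = m.1 ∧ cl G U (M.pt l) = C ∧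
      α + β ≤ η ∧ Nr G α v (M.pt l) ∧ Nr G β v (R.P i (M.pos l))}
  | _, .inr _ => ∅

def Asm.H (M : Asm R J η c Rc Km) (U : Set V) (N : ℕ) : SimpleGraph (WT V k N) where
  Adj w w' := M.Ar U N w w' ∨ M.Ar U N w' w
  symm := ⟨fun _ _ h => h.symm⟩
  loopless := ⟨by
    rintro (⟨i, m⟩ | C) (h | h)
    · have := h.2.1; omega
    · have := h.2.1; omega
    · exact h
    · exact h⟩

/-- the row path in the auxiliary graph -/
theorem Asm.row_conn (M : Asm R J η c Rc Km) (U : Set V) (N : ℕ) (i : Fin k) (hN : M.B i ≤ N)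
    {a b : ℕ} (hab : a ≤ b) (hb : b ≤ M.B i) :
    Conn (M.H U N) {w | ∃ m : Fin (N + 1), w = .inl (i, m) ∧ a ≤ m.1 ∧ m.1 ≤ b}
      (.inl (i, ⟨a, by omega⟩)) (.inl (i, ⟨b, by omega⟩)) := by
  induction b, hab using Nat.le_induction with
  | base => exact Conn.refl ⟨_, rfl, le_rfl, le_rfl⟩
  | succ b hab ih =>
    have h1 := (ih (by omega)).mono (U' := {w | ∃ m : Fin (N + 1), w = .inl (i, m) ∧ a ≤ m.1 ∧ m.1 ≤ b + 1}) (by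
      rintro w ⟨m, rfl, h1, h2⟩
      exact ⟨m, rfl, h1, by omega⟩)
    refine h1.trans (Conn.adj (Or.inl ⟨rfl, rfl, hb⟩) h1.right ⟨_, rfl, ?_, le_rfl⟩)
    show a ≤ b + 1
    omega

theorem Rows.conn_Icc (R : Rows G S T k r s D D1) (i : Fin k) {lo hi a b : ℕ} (hh : hi ≤ R.n i)
    (ha : lo ≤ a) (ha' : a ≤ hi) (hb : lo ≤ b) (hb' : b ≤ hi) :
    Conn G {v | ∃ a, lo ≤ a ∧ a ≤ hi ∧ v = R.P i a} (R.P i a) (R.P i b) := by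
  rcases le_total a b with h | h
  · refine (R.NI_sub i h (by omega)).conn.mono ?_
    rintro _ ⟨x, ⟨h1, h2⟩, rfl⟩
    exact ⟨x, by omega, by omega, rfl⟩
  · refine (R.NI_sub i h (by omega)).conn.symm.mono ?_
    rintro _ ⟨x, ⟨h1, h2⟩, rfl⟩
    exact ⟨x, by omega, by omega, rfl⟩

theorem Asm.assemble [Finite V] (M : Asm R J η c Rc Km) (h1 : c + Rc + Km < η)
    (h2 : η + c + Rc + Km ≤ s) (h3 : 2 * s + η ≤ r)
    {U : Set V} (hU : M.AS ⊆ U) (hUR : ∀ u ∈ U, ∃ a ∈ M.AS, NI G U Rc u a)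
    (hUc : ∀ x ∈ U, ∀ y ∈ U, Nr G c x y → Conn G U x y) :
    ∃ Z : Fin (k + 1) → Set V, (∀ i, ST G S T (Z i)) ∧ ∀ i j, i ≠ j → Far G c (Z i) (Z j) := by
  classical
  obtain ⟨N, hN⟩ : ∃ N, ∀ i, M.B i ≤ N := ⟨Finset.univ.sup M.B, fun i => Finset.le_sup (Finset.mem_univ i)⟩
  have hQU : ∀ j, M.Q j ⊆ U := fun j x hx => hU (Or.inl ⟨j, hx⟩)
  have hptU : ∀ l, M.pt l ∈ U := fun l => hQU _ (M.ptQ l)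
  have hclj : ∀ j b b', cl G U (M.pt (j, b)) = cl G U (M.pt (j, b')) := fun j b b' =>
    cl_eq ((M.Qc j _ (M.ptQ (j, b)) _ (M.ptQ (j, b'))).mono (hQU j))
  -- component against a row vertex
  have hCR : ∀ v ∈ U, ∀ i a, a ≤ R.n i → ¬ Nr G c v (R.P i a) := by
    intro v hv i a ha hn
    obtain ⟨g, hg, hvg⟩ := hUR v hv
    exact M.far_row h1 (by omega) hg ha ((hvg.nr.symm.trans hn).mono (by omega))
  have hlon : ∀ i m, m ≤ M.B i → M.lo i m ≤ R.n i := fun i m hm => (M.lohi i m hm).trans (M.hin i m hm)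
  set SA : Set (WT V k N) := {w | (∃ i, w = .inl (i, ⟨0, by omega⟩)) ∨
    ∃ j, M.row (j, false) = none ∧ w = .inr (cl G U (M.pt (j, false)))} with hSA
  set TB : Set (WT V k N) := {w | (∃ i, w = .inl (i, ⟨M.B i, by have := hN i; omega⟩)) ∨
    ∃ j, M.row (j, true) = none ∧ w = .inr (cl G U (M.pt (j, true)))} with hTB
  have F1 : ∀ w w', w ≠ w' → Far G c (M.Aw U N w) (M.Aw U N w') := by
    have hsame : ∀ i m m', m < m' → m' ≤ M.B i → ∀ a b, a ≤ M.hi i m → M.lo i m' ≤ b → b ≤ M.hi i m' →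
        ¬ Nr G c (R.P i a) (R.P i b) := by
      intro i m m' hm hm' a b ha hb hb' hn
      have := M.sep i m m' hm hm'
      have e1 := M.hin i m (by omega)
      have e2 := M.hin i m' hm'
      have := (R.F i i a b (by omega) (by omega) (hn.mono (by omega))).2
      omega
    rintro (⟨i, m⟩ | C) (⟨i', m'⟩ | C') hne
    · rintro _ ⟨hm, a, ha1, ha2, rfl⟩ _ ⟨hm', b, hb1, hb2, rfl⟩ hn
      have e1 := M.hin i m hm
      have e2 := M.hin i' m' hm'
      obtain ⟨rfl, -, -⟩ := R.F i i' a b (by omega) (by omega) (hn.mono (by omega))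
      rcases lt_trichotomy m.1 m'.1 with h | h | h
      · exact hsame i m m' h hm' a b ha2 hb1 hb2 hn
      · exact hne (by rw [Fin.ext h])
      · exact hsame i m' m h hm b a hb2 ha1 ha2 hn.symm
    · rintro _ ⟨hm, a, ha1, ha2, rfl⟩ v ⟨hv, -⟩ hn
      exact hCR v hv i a (ha2.trans (M.hin i m hm)) hn.symm
    · rintro v ⟨hv, -⟩ _ ⟨hm, a, ha1, ha2, rfl⟩ hn
      exact hCR v hv i' a (ha2.trans (M.hin i' m' hm)) hn
    · rintro v ⟨hv, rfl⟩ v' ⟨hv', rfl⟩ hn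
      exact hne (by rw [cl_eq (hUc v hv v' hv' hn)])
  have F2o : ∀ w w' x, x ≠ w → x ≠ w' → Far G c (M.Ed U N w w') (M.Aw U N x) := by
    rintro (⟨i, m⟩ | C) (⟨i', m'⟩ | C') (⟨j, t⟩ | C2) hx1 hx2
    · rintro _ ⟨rfl, hmm, hm', a, ha1, ha2, rfl⟩ _ ⟨ht, b, hb1, hb2, rfl⟩ hn
      have e1 := hlon i m' hm'
      have e2 := M.hin j t ht
      obtain ⟨rfl, e3, e4⟩ := R.F i j a b (by omega) (by omega) (hn.mono (by omega))
      have hne1 : t.1 ≠ m.1 := fun h => hx1 (by rw [Fin.ext h])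
      have hne2 : t.1 ≠ m'.1 := fun h => hx2 (by rw [Fin.ext h])
      rcases lt_or_gt_of_ne hne1 with h | h
      · have := M.sep i t m h (by omega)
        have := M.lohi i m (by omega)
        omega
      · have := M.sep i m' t (by omega) ht
        have := M.lohi i m' (by omega)
        omega
    · rintro _ ⟨rfl, hmm, hm', a, ha1, ha2, rfl⟩ v ⟨hv, -⟩ hn
      exact hCR v hv i a (ha2.trans (hlon i m' hm')) hn.symm
    · rintro _ ⟨⟩
    · rintro _ ⟨⟩
    · rintro u ⟨l, α, β, hr, hix, hcl, hab, hα, hβ⟩ _ ⟨ht, b, hb1, hb2, rfl⟩ hn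
      have e2 := M.hin j t ht
      obtain ⟨rfl, e3, e4⟩ := R.F i' j _ b (M.near l i' hr).1 (by omega) ((hβ.symm.trans hn).mono (by omega))
      have hne2 : t.1 ≠ m'.1 := fun h => hx2 (by rw [Fin.ext h])
      rcases lt_or_gt_of_ne hne2 with h | h
      · have := M.ixl l i' t hr (by omega)
        omega
      · have := M.ixr l i' t hr ht (by omega)
        omega
    · rintro u ⟨l, α, β, hr, hix, rfl, hab, hα, hβ⟩ v ⟨hv, rfl⟩ hn
      exact hx1 (by rw [cl_eq (M.bit h2 (by omega) hU hUR hr hab hα hβ hv hn)])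
    · rintro _ ⟨⟩
    · rintro _ ⟨⟩
  have F3o : ∀ w w' x x', w ≠ x → w ≠ x' → w' ≠ x → w' ≠ x' →
      Far G c (M.Ed U N w w') (M.Ed U N x x') := by
    have hRC : ∀ (i : Fin k) (m m' : Fin (N + 1)) (C : Set V) (j : Fin k) (t : Fin (N + 1)),
        (.inl (i, m) : WT V k N) ≠ .inl (j, t) → (.inl (i, m') : WT V k N) ≠ .inl (j, t) →
        Far G c (M.Ed U N (.inl (i, m)) (.inl (i, m'))) (M.Ed U N (.inr C) (.inl (j, t))) := by
      rintro i m m' C j t hne1 hne2 _ ⟨-, hmm, hm', a, ha1, ha2, rfl⟩ u ⟨l, α, β, hr, hix, hcl, hab, hα, hβ⟩ hn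
      have e1 := hlon i m' hm'
      obtain ⟨rfl, e3, e4⟩ := R.F i j a _ (by omega) (M.near l j hr).1 ((hn.trans hβ).mono (by omega))
      have hne1 : m.1 ≠ t.1 := fun h => hne1 (by rw [Fin.ext h])
      have hne2 : m'.1 ≠ t.1 := fun h => hne2 (by rw [Fin.ext h])
      rcases lt_or_gt_of_ne hne1 with h | h
      · have := M.ixl l i m' hr (by omega)
        have := M.lohi i m' hm'
        omega
      · have := M.ixr l i m hr (by omega) (by omega)
        have := M.lohi i m (by omega)
        omega
    have hRR : ∀ (i : Fin k) (m m' t t' : Fin (N + 1)), m'.1 = m.1 + 1 → t'.1 = t.1 + 1 →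
        m'.1 < t.1 → t'.1 ≤ M.B i → ∀ a b, a ≤ M.lo i m' → M.hi i t ≤ b → b ≤ R.n i → ¬ Nr G c (R.P i a) (R.P i b) := by
      intro i m m' t t' hm ht hlt htB a b ha hb hbn hn
      have e1 := M.sep i m' t hlt (by omega)
      have e2 := M.lohi i m' (by omega)
      have e3 := M.lohi i t (by omega)
      have := R.F i i a b (by omega) hbn (hn.mono (by omega))
      omega
    rintro (⟨i, m⟩ | C) (⟨i', m'⟩ | C') (⟨j, t⟩ | C2) (⟨j', t'⟩ | C2') hne1 hne2 hne3 hne4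
    · rintro _ ⟨rfl, hmm, hm', a, ha1, ha2, rfl⟩ _ ⟨rfl, htt, ht', b, hb1, hb2, rfl⟩ hn
      have e1 := hlon i m' hm'
      have e2 := hlon j t' ht'
      obtain ⟨rfl, -, -⟩ := R.F i j a b (by omega) (by omega) (hn.mono (by omega))
      have k1 : m.1 ≠ t.1 := fun h => hne1 (by rw [Fin.ext h])
      have k2 : m.1 ≠ t'.1 := fun h => hne2 (by rw [Fin.ext h])
      have k3 : m'.1 ≠ t.1 := fun h => hne3 (by rw [Fin.ext h])
      rcases lt_or_gt_of_ne k1 with h | h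
      · exact hRR i m m' t t' hmm htt (by omega) ht' a b ha2 hb1 (by omega) hn
      · exact hRR i t t' m m' htt hmm (by omega) hm' b a hb2 ha1 (by omega) hn.symm
    · rintro _ _ _ ⟨⟩
    · rintro v hv
      obtain ⟨rfl, -⟩ := id hv
      exact hRC i m m' C2 j' t' hne2 hne4 v hv
    · rintro _ _ _ ⟨⟩
    · rintro _ ⟨⟩
    · rintro _ ⟨⟩
    · rintro _ ⟨⟩
    · rintro _ ⟨⟩
    · rintro v hv u hu
      obtain ⟨rfl, -⟩ := id hu
      exact (hRC j t t' C i' m' hne3.symm hne4.symm).symm v hv u hu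
    · rintro _ _ _ ⟨⟩
    · rintro u ⟨l, α, β, hr, hix, hcl, hab, hα, hβ⟩ u' ⟨l', α', β', hr', hix', hcl', hab', hα', hβ'⟩ hn
      obtain ⟨rfl, e3, e4⟩ := R.F i' j' _ _ (M.near l i' hr).1 (M.near l' j' hr').1
        (((hβ.symm.trans hn).trans hβ').mono (by omega))
      have := M.ix_eq hr hr' e4 e3
      exact hne4 (by rw [Fin.ext (hix.symm.trans (this.trans hix'))])
    · rintro _ _ _ ⟨⟩
    · rintro _ ⟨⟩
    · rintro _ ⟨⟩
    · rintro _ ⟨⟩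
    · rintro _ ⟨⟩
  have hEo : ∀ w w', M.Ar U N w w' → ∃ a ∈ M.Aw U N w, ∃ b ∈ M.Aw U N w',
      Conn G (M.Aw U N w ∪ M.Ed U N w w' ∪ M.Aw U N w') a b := by
    rintro (⟨i, m⟩ | C) (⟨i', m'⟩ | C') h
    · obtain ⟨rfl, hmm, hm'⟩ := h
      have e0 := M.lohi i m (by omega)
      have e1 := M.lohi i m' hm'
      have e2 := M.sep i m m' (by omega) hm'
      refine ⟨R.P i (M.hi i m), ⟨by omega, _, e0, le_rfl, rfl⟩, R.P i (M.lo i m'), ⟨hm', _, le_rfl, e1, rfl⟩, ?_⟩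
      refine (R.conn_Icc i (hlon i m' hm') (lo := M.hi i m) le_rfl (by omega) (by omega) le_rfl).mono ?_
      rintro v ⟨a, ha, hb, rfl⟩
      exact Or.inl (Or.inr ⟨rfl, hmm, hm', a, ha, hb, rfl⟩)
    · exact absurd h (by simp [Asm.Ar])
    · obtain ⟨l, hr, hix, rfl⟩ := h
      have hb := M.ixB l i' hr
      refine ⟨M.pt l, ⟨hptU l, rfl⟩, R.P i' (M.pos l), ⟨by omega, _, hix ▸ M.ixlo l i' hr, hix ▸ M.ixhi l i' hr, rfl⟩, ?_⟩
      obtain ⟨w, hw⟩ := (M.near l i' hr).2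
      refine ⟨w, fun v hv => Or.inl (Or.inr ?_)⟩
      obtain ⟨w1, w2, hl, -, -⟩ := walk_split w hv
      exact ⟨l, w1.length, w2.length, hr, hix, rfl, by omega, Nr.symm ⟨w1, le_rfl⟩, ⟨w2, le_rfl⟩⟩
    · exact absurd h (by simp [Asm.Ar])
  refine fat_menger (M.H U N) (M.Aw U N) (fun w w' => M.Ed U N w w' ∪ M.Ed U N w' w) S T SA TB c k
    ?_ ?_ F1 ?_ ?_ ?_ ?_ ?_
  · rintro (⟨i, m⟩ | C)
    · rintro _ ⟨hm, a, ha1, ha2, rfl⟩ _ ⟨hm', b, hb1, hb2, rfl⟩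
      refine (R.conn_Icc i (M.hin i m hm) ha1 ha2 hb1 hb2).mono ?_
      rintro v ⟨a, ha, hb, rfl⟩
      exact ⟨hm, a, ha, hb, rfl⟩
    · rintro a ⟨ha, rfl⟩ b ⟨hb, hab⟩
      obtain ⟨w, hw⟩ := conn_of_cl hb hab.symm
      refine ⟨w, fun v hv => ⟨hw v hv, ?_⟩⟩
      obtain ⟨w1, w2, hl, h1, -⟩ := walk_split w hv
      exact (cl_eq ⟨w1, fun x hx => hw x (h1 x hx)⟩).symm
  · rintro w w' (h | h)
    · obtain ⟨a, ha, b, hb, hc⟩ := hEo w w' h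
      refine ⟨a, ha, b, hb, hc.mono ?_⟩
      rintro v ((hv | hv) | hv)
      · exact Or.inl (Or.inl hv)
      · exact Or.inl (Or.inr (Or.inl hv))
      · exact Or.inr hv
    · obtain ⟨a, ha, b, hb, hc⟩ := hEo w' w h
      refine ⟨b, hb, a, ha, hc.symm.mono ?_⟩
      rintro v ((hv | hv) | hv)
      · exact Or.inr hv
      · exact Or.inl (Or.inr (Or.inr hv))
      · exact Or.inl (Or.inl hv)
  · rintro w w' x - hx hx' v (hv | hv)
    · exact F2o w w' x hx hx' v hv
    · exact F2o w' w x hx' hx v hv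
  · rintro w w' x x' - - n1 n2 n3 n4 v (hv | hv) u (hu | hu)
    · exact F3o w w' x x' n1 n2 n3 n4 v hv u hu
    · exact F3o w w' x' x n2 n1 n4 n3 v hv u hu
    · exact F3o w' w x x' n3 n4 n1 n2 v hv u hu
    · exact F3o w' w x' x n4 n3 n2 n1 v hv u hu
  · rintro w (⟨i, rfl⟩ | ⟨j, hj, rfl⟩)
    · exact ⟨R.P i 0, R.hS i, Nat.zero_le _, 0, (M.lo0 i).le, Nat.zero_le _, rfl⟩
    · exact ⟨_, M.src j hj, hptU _, rfl⟩
  · rintro w (⟨i, rfl⟩ | ⟨j, hj, rfl⟩)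
    · exact ⟨R.P i (R.n i), R.hT i, le_rfl, R.n i, hlon i _ le_rfl, (M.hiB i).ge, rfl⟩
    · exact ⟨_, M.tgt j hj, hptU _, rfl⟩
  · intro X hX
    by_cases hrow : ∃ i, ∀ m : Fin (N + 1), m.1 ≤ M.B i → (.inl (i, m) : WT V k N) ∉ X
    · obtain ⟨i, hi⟩ := hrow
      refine ⟨_, ⟨_, Or.inl ⟨i, rfl⟩, _, Or.inl ⟨i, rfl⟩, M.row_conn U N i (hN i) (Nat.zero_le _) le_rfl⟩, ?_⟩
      rw [Set.disjoint_left]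
      rintro w ⟨m, rfl, -, hm⟩
      exact hi m hm
    · push Not at hrow
      choose m hmB hmX using hrow
      have hinj : Function.Injective (fun i => (.inl (i, m i) : WT V k N)) := by
        intro i j hij
        simp only [Sum.inl.injEq, Prod.mk.injEq] at hij
        exact hij.1
      have himg : Finset.univ.image (fun i => (.inl (i, m i) : WT V k N)) = X := by
        apply Finset.eq_of_subset_of_card_le
        · intro w hw
          obtain ⟨i, -, rfl⟩ := Finset.mem_image.1 hw
          exact hmX i
        · rw [Finset.card_image_of_injective _ hinj]; simpa using hX
      obtain ⟨j, hj1, hj2⟩ := M.dom (fun i => (m i).1) hmB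
      refine ⟨(X : Set (WT V k N))ᶜ, ?_, disjoint_compl_left⟩
      have hXi : ∀ i t, (.inl (i, t) : WT V k N) ∈ X → t = m i := by
        intro i t ht
        rw [← himg] at ht
        obtain ⟨i', -, h⟩ := Finset.mem_image.1 ht
        simp only [Sum.inl.injEq, Prod.mk.injEq] at h
        rw [← h.2, h.1]
      have hXr : ∀ C, (.inr C : WT V k N) ∉ X := by
        intro C hC
        rw [← himg] at hC
        obtain ⟨i', -, h⟩ := Finset.mem_image.1 hC
        cases h
      have hs : ∃ a ∈ SA, Conn (M.H U N) (X : Set (WT V k N))ᶜ a (.inr (cl G U (M.pt (j, false)))) := by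
        cases hr : M.row (j, false) with
        | none => exact ⟨_, Or.inr ⟨j, hr, rfl⟩, Conn.refl (hXr _)⟩
        | some i =>
          have e1 := hj1 i hr
          have e2 := hN i
          have e3 := M.ixB _ i hr
          refine ⟨_, Or.inl ⟨i, rfl⟩, ?_⟩
          have hc := (M.row_conn U N i e2 (Nat.zero_le _) e3).mono (U' := (X : Set (WT V k N))ᶜ) (by
            rintro w ⟨t, rfl, -, ht⟩ hX
            have := hXi i t hX
            subst this
            omega)
          exact hc.trans (Conn.adj (Or.inr ⟨(j, false), hr, rfl, rfl⟩) hc.right (hXr _))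
      have ht : ∃ a ∈ TB, Conn (M.H U N) (X : Set (WT V k N))ᶜ (.inr (cl G U (M.pt (j, true)))) a := by
        cases hr : M.row (j, true) with
        | none => exact ⟨_, Or.inr ⟨j, hr, rfl⟩, Conn.refl (hXr _)⟩
        | some i =>
          have e1 := hj2 i hr
          have e2 := hN i
          have e3 := M.ixB _ i hr
          refine ⟨_, Or.inl ⟨i, rfl⟩, ?_⟩
          have hc := (M.row_conn U N i e2 e3 le_rfl).mono (U' := (X : Set (WT V k N))ᶜ) (by
            rintro w ⟨t, rfl, ht, -⟩ hX
            have := hXi i t hX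
            subst this
            omega)
          exact (Conn.adj (Or.inl ⟨(j, true), hr, rfl, rfl⟩) (hXr _) hc.left).trans hc
      obtain ⟨a, ha, hca⟩ := hs
      obtain ⟨b, hb, hcb⟩ := ht
      rw [hclj j true false] at hcb
      exact ⟨a, ha, b, hb, hca.trans hcb⟩
end
end CM
open SimpleGraph
namespace CM

theorem pareto (Jb : ℕ → ℕ → Prop) (N : ℕ) (hN : ∀ a b, Jb a b → b ≤ N) {a0 b0 : ℕ} (h0 : Jb a0 b0) :
    ∃ a b, a ≤ a0 ∧ b0 ≤ b ∧ Jb a b ∧ ∀ a' b', Jb a' b' → a' ≤ a → b ≤ b' → a' = a ∧ b' = b := by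
  classical
  have hex : ∃ a, ∃ b, b0 ≤ b ∧ Jb a b := ⟨a0, b0, le_rfl, h0⟩
  have hb := Nat.find_spec hex
  set a := Nat.find hex with ha
  have hmin : ∀ a', (∃ b, b0 ≤ b ∧ Jb a' b) → a ≤ a' := fun a' h => Nat.find_min' hex h
  obtain ⟨b1, hb1, hJ1⟩ := hb
  have hspec := Nat.findGreatest_spec (P := fun b => b0 ≤ b ∧ Jb a b) (hN a b1 hJ1) ⟨hb1, hJ1⟩
  set b := Nat.findGreatest (fun b => b0 ≤ b ∧ Jb a b) N with hbdef
  refine ⟨a, b, hmin a0 ⟨b0, le_rfl, h0⟩, hspec.1, hspec.2, ?_⟩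
  intro a' b' hJ h1 h2
  have e1 : a' = a := le_antisymm h1 (hmin a' ⟨b', by omega, hJ⟩)
  rw [e1] at hJ
  refine ⟨e1, le_antisymm ?_ h2⟩
  exact Nat.le_findGreatest (P := fun b => b0 ≤ b ∧ Jb a b) (hN _ _ hJ) ⟨by omega, hJ⟩

theorem cut_one {L Λ : Type*} [Fintype Λ] (act : L → Prop) (pos : L → ℕ) (lab : L → Λ) (g e b : ℕ)
    (hg : 0 < g) (he : e = 4 * g * (Fintype.card Λ + 1))
    (hu : ∀ l l', act l → act l' → pos l / e = pos l' / e → lab l = lab l' → l = l') :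
    ∃ ct, b * e + 2 * g ≤ ct ∧ ct + 2 * g ≤ (b + 1) * e ∧
      ∀ l, act l → pos l + 2 * g ≤ ct ∨ ct + 2 * g ≤ pos l := by
  have he0 : 0 < e := by rw [he]; positivity
  obtain ⟨t, ht, hbad⟩ := pigeon (Θ := Λ) (fun θ t => ∃ l, act l ∧ pos l / e = b ∧ lab l = θ ∧
    pos l < b * e + 2 * g + 4 * g * t + 2 * g ∧ b * e + 2 * g + 4 * g * t < pos l + 2 * g) (by
    rintro θ t t' ⟨l, h1, h2, h3, h4, h5⟩ ⟨l', h1', h2', h3', h4', h5'⟩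
    obtain rfl := hu l l' h1 h1' (h2.trans h2'.symm) (h3.trans h3'.symm)
    rcases lt_trichotomy t t' with h | h | h
    · have := Nat.mul_le_mul_left (4 * g) (Nat.succ_le_of_lt h)
      rw [Nat.succ_eq_add_one, mul_add, mul_one] at this
      omega
    · exact h
    · have := Nat.mul_le_mul_left (4 * g) (Nat.succ_le_of_lt h)
      rw [Nat.succ_eq_add_one, mul_add, mul_one] at this
      omega)
  have h1 := Nat.mul_le_mul_left (4 * g) ht
  have h2 : (b + 1) * e = b * e + e := by ring
  have h3 : e = 4 * g * Fintype.card Λ + 4 * g := by rw [he]; ring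
  refine ⟨b * e + 2 * g + 4 * g * t, by omega, by omega, ?_⟩
  intro l hl
  by_contra hcon
  push Not at hcon
  refine hbad (lab l) ⟨l, hl, ?_, rfl, by omega, by omega⟩
  apply Nat.div_eq_of_lt_le
  · omega
  · show _ < (b + 1) * e
    omega

theorem cuts {L Λ : Type*} [Fintype Λ] {k : ℕ} (n : Fin k → ℕ) (row : L → Option (Fin k))
    (pos : L → ℕ) (lab : L → Λ) (g D e : ℕ)
    (hg : D < g) (he : e = 4 * g * (Fintype.card Λ + 1))
    (hpos : ∀ l i, row l = some i → pos l ≤ n i)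
    (hu : ∀ l l' i, row l = some i → row l' = some i → pos l / e = pos l' / e →
      lab l = lab l' → l = l') :
    ∃ (lo hi : Fin k → ℕ → ℕ) (ix : L → ℕ), (∀ i, lo i 0 = 0) ∧ (∀ i, hi i (n i / e) = n i) ∧
      (∀ i m, m ≤ n i / e → lo i m ≤ hi i m) ∧ (∀ i m, m ≤ n i / e → hi i m ≤ n i) ∧
      (∀ i m m', m < m' → m' ≤ n i / e → hi i m + D < lo i m') ∧
      (∀ l i, row l = some i → ix l ≤ n i / e) ∧
      (∀ l i, row l = some i → lo i (ix l) ≤ pos l) ∧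
      (∀ l i, row l = some i → pos l ≤ hi i (ix l)) ∧
      (∀ l i m, row l = some i → m < ix l → hi i m + D < pos l) ∧
      (∀ l i m, row l = some i → m ≤ n i / e → ix l < m → pos l + D < lo i m) ∧
      (∀ l i, row l = some i → pos l / e ≤ ix l ∧ ix l ≤ pos l / e + 1) := by
  classical
  have hg0 : 0 < g := by omega
  have he0 : 0 < e := by rw [he]; positivity
  choose ct h1 h2 h3 using fun (i : Fin k) (b : ℕ) =>
    cut_one (fun l => row l = some i) pos lab g e b (by omega) he (fun l l' => hu l l' i)
  have hmul : ∀ a b, a ≤ b → a * e ≤ b * e := fun a b h => Nat.mul_le_mul_right e h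
  have hmono : ∀ i b b', b < b' → ct i b + 4 * g ≤ ct i b' := by
    intro i b b' h
    have := hmul (b + 1) b' h
    have := h1 i b'
    have := h2 i b
    omega
  have hB : ∀ i, n i / e * e ≤ n i := fun i => Nat.div_mul_le_self _ _
  set ix : L → ℕ := fun l => match row l with
    | none => 0
    | some i => if pos l / e = n i / e ∨ pos l < ct i (pos l / e) then pos l / e else pos l / e + 1
    with hix
  have hixe : ∀ l i, row l = some i → ix l = if pos l / e = n i / e ∨ pos l < ct i (pos l / e)
      then pos l / e else pos l / e + 1 := by
    intro l i h
    simp only [hix, h]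
  have hb : ∀ l i, row l = some i → pos l / e ≤ ix l ∧ ix l ≤ pos l / e + 1 := by
    intro l i h
    rw [hixe l i h]
    split_ifs <;> omega
  have hle : ∀ l i, row l = some i → ix l ≤ n i / e := by
    intro l i h
    rw [hixe l i h]
    have : pos l / e ≤ n i / e := Nat.div_le_div_right (hpos l i h)
    split_ifs with h
    · omega
    · push Not at h
      omega
  have k1 : ∀ l i m, row l = some i → m < ix l → ct i m + 2 * g ≤ pos l := by
    intro l i m h hm
    rw [hixe l i h] at hm
    have e1 := Nat.div_mul_le_self (pos l) e
    have e2 := h2 i m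
    rcases lt_or_ge m (pos l / e) with h4 | h4
    · have := hmul (m + 1) _ h4
      omega
    · split_ifs at hm with h5
      · omega
      · push Not at h5
        have : m = pos l / e := by omega
        subst this
        have := h3 i (pos l / e) l h
        omega
  have k2 : ∀ l i m, row l = some i → ix l ≤ m → m < n i / e → pos l + 2 * g ≤ ct i m := by
    intro l i m h hm hmB
    rw [hixe l i h] at hm
    have e1 : pos l < (pos l / e + 1) * e := by
      have := Nat.lt_div_mul_add (a := pos l) he0
      rw [add_mul, one_mul]; omega
    rcases lt_or_ge (pos l / e) m with h4 | h4
    · have := hmul _ m h4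
      have := h1 i m
      simp only [Nat.succ_eq_add_one] at *
      omega
    · split_ifs at hm with h5
      · have : m = pos l / e := by omega
        subst this
        have := h3 i (pos l / e) l h
        omega
      · omega
  have hge : ∀ i m, 2 * g ≤ ct i m := fun i m => by have := h1 i m; omega
  have hend : ∀ i m, m < n i / e → ct i m + 2 * g ≤ n i := by
    intro i m h
    have := hmul (m + 1) _ h
    have := h2 i m
    have := hB i
    omega
  refine ⟨fun i m => if m = 0 then 0 else ct i (m - 1) + g,
    fun i m => if m < n i / e then ct i m - g else n i, ix, ?_, ?_, ?_, ?_, ?_, hle, ?_, ?_, ?_, ?_, hb⟩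
  · intro i; simp
  · intro i; simp
  · intro i m hm
    dsimp only
    split_ifs with h4 h5 h5
    · omega
    · omega
    · have := hmono i (m - 1) m (by omega)
      omega
    · have := hend i (m - 1) (by omega)
      omega
  · intro i m hm
    dsimp only
    split_ifs with h4
    · have := hend i m h4
      omega
    · exact le_rfl
  · intro i m m' h hm
    dsimp only
    rw [if_pos (by omega), if_neg (by omega)]
    have := hge i m
    rcases Nat.lt_or_ge m (m' - 1) with h4 | h4
    · have := hmono i m (m' - 1) h4
      omega
    · have : m' - 1 = m := by omega
      rw [this]; omega
  · intro l i h
    dsimp only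
    split_ifs with h4
    · omega
    · have := k1 l i (ix l - 1) h (by omega)
      omega
  · intro l i h
    dsimp only
    split_ifs with h4
    · have := k2 l i (ix l) h le_rfl h4
      omega
    · exact hpos l i h
  · intro l i m h hm
    dsimp only
    have := hle l i h
    rw [if_pos (by omega)]
    have := k1 l i m h hm
    have := hge i m
    omega
  · intro l i m h hmB hm
    dsimp only
    rw [if_neg (by omega)]
    have := k2 l i (m - 1) h (by omega) (by omega)
    omega

theorem scales {V L Λ : Type*} [Fintype Λ] {k : ℕ} (G : SimpleGraph V) (row : L → Option (Fin k))
    (blk ix : L → ℕ) (lab : L → Λ) (pt : L → V) (w : ℕ)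
    (hb : ∀ l i, row l = some i → blk l ≤ ix l ∧ ix l ≤ blk l + 1)
    (hu : ∀ l l' i, row l = some i → row l' = some i → blk l = blk l' →
      lab l = lab l' → l = l') :
    ∃ κ : Fin k → ℕ → ℕ, (∀ i m, w ≤ κ i m) ∧
      (∀ i m, κ i m ≤ w * (Fintype.card ((Bool × Λ) × (Bool × Λ)) + 1)) ∧
      ∀ l l' i, row l = some i → row l' = some i → ix l = ix l' →
        Nr G (κ i (ix l) + w) (pt l) (pt l') → Nr G (κ i (ix l)) (pt l) (pt l') := by
  classical
  have key : ∀ (i : Fin k) (m : ℕ), ∃ t, t ≤ Fintype.card ((Bool × Λ) × (Bool × Λ)) ∧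
      ∀ l l', row l = some i → row l' = some i → ix l = m → ix l' = m →
        Nr G (w * (t + 1) + w) (pt l) (pt l') → Nr G (w * (t + 1)) (pt l) (pt l') := by
    intro i m
    obtain ⟨t, ht, hbad⟩ := pigeon (Θ := (Bool × Λ) × (Bool × Λ)) (fun θ t => ∃ l l',
      row l = some i ∧ row l' = some i ∧ ix l = m ∧ ix l' = m ∧
      θ = ((decide (blk l = m), lab l), (decide (blk l' = m), lab l')) ∧
      Nr G (w * (t + 1) + w) (pt l) (pt l') ∧ ¬ Nr G (w * (t + 1)) (pt l) (pt l')) (by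
      rintro θ t t' ⟨l, l', h1, h2, h3, h4, h5, h6, h7⟩ ⟨a, a', g1, g2, g3, g4, g5, g6, g7⟩
      rw [h5] at g5
      simp only [Prod.mk.injEq, decide_eq_decide] at g5
      obtain ⟨⟨d1, d2⟩, d3, d4⟩ := g5
      obtain rfl := hu l a i h1 g1 (by have := hb l i h1; have := hb a i g1; omega) d2
      obtain rfl := hu l' a' i h2 g2 (by have := hb l' i h2; have := hb a' i g2; omega) d4
      rcases lt_trichotomy t t' with h | h | h
      · have := Nat.mul_le_mul_left w (Nat.succ_le_succ h)
        exact absurd (h6.mono (by rw [← mul_add_one]; exact this)) g7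
      · exact h
      · have := Nat.mul_le_mul_left w (Nat.succ_le_succ h)
        exact absurd (g6.mono (by rw [← mul_add_one]; exact this)) h7)
    refine ⟨t, ht, fun l l' h1 h2 h3 h4 h5 => ?_⟩
    by_contra h6
    exact hbad _ ⟨l, l', h1, h2, h3, h4, rfl, h5, h6⟩
  choose t ht hk using key
  refine ⟨fun i m => w * (t i m + 1), fun i m => Nat.le_mul_of_pos_right _ (by omega),
    fun i m => Nat.mul_le_mul_left _ (by have := ht i m; omega), ?_⟩
  intro l l' i h1 h2 h3 h4
  exact hk i (ix l) l l' h1 h2 rfl h3.symm h4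
end CM
open SimpleGraph
namespace CM

section
variable {V : Type*} {G : SimpleGraph V} {S T : Set V} {k r s D D1 : ℕ}

def JB (R : Rows G S T k r s D D1) (η e : ℕ) (σ τ : Option (Fin k)) (a b : ℕ) : Prop :=
  ∃ z y w0 w1 Q, IsJump R η σ z τ y w0 w1 Q ∧ z / e = a ∧ y / e = b

def Kept (R : Rows G S T k r s D D1) (η e : ℕ) (σ τ : Option (Fin k)) (a b : ℕ) : Prop :=
  JB R η e σ τ a b ∧ ∀ a' b', JB R η e σ τ a' b' → a' ≤ a → b ≤ b' → a' = a ∧ b' = b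

theorem exists_kept (R : Rows G S T k r s D D1) (η e : ℕ) (σ τ : Option (Fin k)) {a0 b0 : ℕ}
    (h : JB R η e σ τ a0 b0) : ∃ a b, a ≤ a0 ∧ b0 ≤ b ∧ Kept R η e σ τ a b := by
  refine pareto (JB R η e σ τ) (match τ with | none => 0 | some i => R.n i) ?_ h
  rintro a b ⟨z, y, w0, w1, Q, hJ, rfl, rfl⟩
  refine (Nat.div_le_self _ _).trans ?_
  cases τ with
  | none => exact (hJ.t0 rfl).2.le
  | some i => exact (hJ.t1 i rfl).1

theorem build (R : Rows G S T k r s D D1) {η e E : ℕ} (c Rc : ℕ) (hη : η ≤ s) (h3 : 3 * s ≤ r)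
    (he : e = 4 * (D + 1) * (Fintype.card (Bool × Option (Fin k)) + 1))
    (hE0 : 2 * e ≤ E) (hE1 : D1 < E) (hE2 : D < 2 * E)
    (hsep : ∀ ξ : Fin k → ℕ, (∀ i, ξ i ≤ R.n i) → ∃ Z, ST G S T Z ∧
      ∀ v ∈ Z, ∀ i, ¬ Nr G (E + s) v (R.P i (ξ i))) :
    ∃ J : Type, Nonempty (Asm R J η c Rc (2 * (c + Rc) *
      (Fintype.card ((Bool × (Bool × Option (Fin k))) × (Bool × (Bool × Option (Fin k)))) + 1))) := by
  classical
  have he0 : 0 < e := by rw [he]; positivity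
  let J : Type := {t : (Option (Fin k) × Option (Fin k)) × ℕ × ℕ // Kept R η e t.1.1 t.1.2 t.2.1 t.2.2}
  have hex : ∀ j : J, ∃ z y w0 w1 Q, IsJump R η j.1.1.1 z j.1.1.2 y w0 w1 Q ∧
    z / e = j.1.2.1 ∧ y / e = j.1.2.2 := fun j => j.2.1
  choose z y w0 w1 Q hJ hz hy using hex
  let row : J × Bool → Option (Fin k) := fun l => if l.2 then l.1.1.1.2 else l.1.1.1.1
  let pos : J × Bool → ℕ := fun l => if l.2 then y l.1 else z l.1
  let pt : J × Bool → V := fun l => if l.2 then w1 l.1 else w0 l.1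
  let lab : J × Bool → Bool × Option (Fin k) := fun l => (l.2, if l.2 then l.1.1.1.1 else l.1.1.1.2)
  have hu : ∀ l l' i, row l = some i → row l' = some i → pos l / e = pos l' / e →
      lab l = lab l' → l = l' := by
    rintro ⟨j, b⟩ ⟨j', b'⟩ i h1 h2 h3 h4
    obtain rfl : b = b' := congrArg Prod.fst h4
    have h5 := congrArg Prod.snd h4
    refine Prod.ext ?_ rfl
    have hz1 := hz j
    have hz2 := hz j'
    have hy1 := hy j
    have hy2 := hy j'
    clear h4
    obtain ⟨⟨⟨σ, τ⟩, α, β⟩, hk⟩ := j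
    obtain ⟨⟨⟨σ', τ'⟩, α', β'⟩, hk'⟩ := j'
    apply Subtype.ext
    cases b
    · simp only [row, pos, lab, Bool.false_eq_true, if_false] at h1 h2 h3 h5 hz1 hz2 hy1 hy2
      simp only at hk hk'
      have : α = α' := by rw [← hz1, ← hz2, h3]
      subst h1 h2 h5 this
      rcases le_total β β' with h | h
      · have := hk.2 _ _ hk'.1 le_rfl h
        simp [this.2]
      · have := hk'.2 _ _ hk.1 le_rfl h
        simp [this.2]
    · simp only [row, pos, lab, if_true] at h1 h2 h3 h5 hz1 hz2 hy1 hy2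
      simp only at hk hk'
      have : β = β' := by rw [← hy1, ← hy2, h3]
      subst h1 h2 h5 this
      rcases le_total α α' with h | h
      · have := hk'.2 _ _ hk.1 h le_rfl
        simp [this.1]
      · have := hk.2 _ _ hk'.1 h le_rfl
        simp [this.1]
  have near : ∀ l i, row l = some i → pos l ≤ R.n i ∧ Nr G η (pt l) (R.P i (pos l)) := by
    rintro ⟨j, b⟩ i h
    cases b
    · exact (hJ j).s1 i h
    · exact (hJ j).t1 i h
  obtain ⟨lo, hi, ix, c1, c2, c3, c4, c5, c6, c7, c8, c9, c10, c11⟩ :=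
    cuts R.n row pos lab (D + 1) D e (by omega) he (fun l i h => (near l i h).1) hu
  obtain ⟨κ, k1, k2, k3⟩ := scales G row (fun l => pos l / e) ix lab pt (2 * (c + Rc)) c11 hu
  refine ⟨J, ⟨⟨fun i => R.n i / e, lo, hi, c1, c2, c3, c4, c5, Q, row, pos, pt, ix, ?_, ?_, near, ?_,
    ?_, ?_, c6, c7, c8, c9, c10, κ, k1, k2, k3, ?_⟩⟩⟩
  · intro j g hg g' hg'
    exact ((hJ j).conn g hg).symm.trans ((hJ j).conn g' hg')
  · rintro ⟨j, b⟩
    cases b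
    · exact (hJ j).m0
    · exact (hJ j).m1
  · intro j g hg m hm i a ha hn
    obtain ⟨h1, h2 | h2⟩ := (hJ j).jp g hg m hm i a ha hn
    · exact ⟨h1, false, h2⟩
    · exact ⟨h1, true, h2⟩
  · intro j h
    exact ((hJ j).s0 h).1
  · intro j h
    exact ((hJ j).t0 h).1
  · intro m hm
    have hξ : ∀ i, m i * e ≤ R.n i := fun i =>
      (Nat.mul_le_mul_right e (hm i)).trans (Nat.div_mul_le_self _ _)
    obtain ⟨Z, hZ, hav⟩ := hsep (fun i => m i * e) hξ
    obtain ⟨σ, z', τ, y', v0, v1, Q', hj, hs', ht'⟩ := extract R hη h3 hE1 hE2 _ hξ Z hZ hav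
    obtain ⟨a, b, ha, hb, hk⟩ := exists_kept R η e σ τ ⟨z', y', v0, v1, Q', hj, rfl, rfl⟩
    let j : J := ⟨((σ, τ), (a, b)), hk⟩
    refine ⟨j, ?_, ?_⟩
    · intro i hi
      have e1 := (c11 (j, false) i hi).2
      have e2 : pos (j, false) / e = a := hz j
      have e3 := hs' i hi
      have e4 : z' / e + 2 ≤ m i := by
        rw [← Nat.add_mul_div_right _ _ he0]
        have : (z' + 2 * e) / e ≤ (m i * e) / e := Nat.div_le_div_right (by omega)
        rwa [Nat.mul_div_cancel _ he0] at this
      omega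
    · intro i hi
      have e1 := (c11 (j, true) i hi).1
      have e2 : pos (j, true) / e = b := hy j
      have e3 := ht' i hi
      have e4 : m i + 2 ≤ y' / e := by
        rw [Nat.le_div_iff_mul_le he0, add_mul]
        omega
      omega
end
end CM
open SimpleGraph
namespace CM

def MainK (p q k : ℕ) : Prop := ∀ c : ℕ, ∃ ℓ : ℕ, ∀ (V : Type) [Fintype V], ∀ G : SimpleGraph V,
  HasPQPathDecomp G p q → ∀ S T : Set V,
    (∃ Z : Fin (k + 1) → Set V, (∀ i, ST G S T (Z i)) ∧ ∀ i j, i ≠ j → Far G c (Z i) (Z j)) ∨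
    (∃ X : Finset V, X.card ≤ k ∧ ∀ Z, ST G S T Z → ∃ y ∈ Z, ∃ x ∈ X, Nr G ℓ y x)

theorem mainK_zero (p q : ℕ) : MainK p q 0 := by
  intro c
  refine ⟨0, fun V _ G _ S T => ?_⟩
  by_cases h : ∃ Z, ST G S T Z
  · obtain ⟨Z, hZ⟩ := h
    exact Or.inl ⟨fun _ => Z, fun _ => hZ, fun i j hij => absurd (Fin.ext (by omega)) hij⟩
  · exact Or.inr ⟨∅, by simp, fun Z hZ => absurd ⟨Z, hZ⟩ h⟩

theorem mainK_succ (p q k : ℕ) (hp : 1 ≤ p) (ih : MainK p q k) : MainK p q (k + 1) := by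
  classical
  intro c
  obtain ⟨Rc, Dc, hU⟩ := lemmaU p q c hp
  obtain ⟨Km, hKm⟩ : ∃ Km, Km = 2 * (c + Rc) * (Fintype.card ((Bool × (Bool × Option (Fin (k + 1)))) ×
    (Bool × (Bool × Option (Fin (k + 1))))) + 1) := ⟨_, rfl⟩
  obtain ⟨η, hη⟩ : ∃ η, η = Km + c + Rc + 1 := ⟨_, rfl⟩
  obtain ⟨s, hs⟩ : ∃ s, s = η + c + Rc + Km := ⟨_, rfl⟩
  obtain ⟨r, hr⟩ : ∃ r, r = 4 * s + 1 := ⟨_, rfl⟩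
  obtain ⟨R', D', hU'⟩ := lemmaU p q (r + 2 * s) hp
  obtain ⟨D, hD⟩ : ∃ D, D = D' + 8 * s := ⟨_, rfl⟩
  obtain ⟨e, he⟩ : ∃ e, e = 4 * (D + 1) * (Fintype.card (Bool × Option (Fin (k + 1))) + 1) := ⟨_, rfl⟩
  obtain ⟨E, hE⟩ : ∃ E, E = 2 * e + 6 * s + D + 1 := ⟨_, rfl⟩
  obtain ⟨ℓ, hℓ⟩ := ih (r + 2 * (R' + 3 * s))
  refine ⟨max ℓ (E + s), fun V _ G hG S T => ?_⟩
  rcases hℓ V G hG S T with ⟨Z, hZ, hF⟩ | ⟨X, hX, hX'⟩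
  swap
  · refine Or.inr ⟨X, by omega, fun Z hZ => ?_⟩
    obtain ⟨y, hy, x, hx, h⟩ := hX' Z hZ
    exact ⟨y, hy, x, hx, h.mono (le_max_left _ _)⟩
  choose U hZU hUn hUc using fun i => hU' V G hG (Z i)
  choose n P a1 a2 a3 a4 a5 a6 a7 using fun i => row (hUc i) ((hZ i).mono subset_rfl subset_rfl (hZU i))
  have hclose : ∀ i a, a ≤ n i → ∃ u ∈ Z i, Nr G (R' + 3 * s) u (P i a) := by
    intro i a ha
    obtain ⟨u, hu, h⟩ := a4 i a ha
    obtain ⟨v, hv, h'⟩ := hUn i u hu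
    exact ⟨v, hv, h'.nr.symm.trans h⟩
  let R : Rows G S T (k + 1) r s D (6 * s) :=
    { n := n, P := P, hS := a1, hT := a2, adj := a3
      F := by
        intro i j a b ha hb h
        by_cases hij : i = j
        · subst hij
          exact ⟨rfl, hD ▸ a5 i a ha b hb h, hD ▸ a5 i b hb a ha h.symm⟩
        · exfalso
          obtain ⟨u, hu, h1⟩ := hclose i a ha
          obtain ⟨v, hv, h2⟩ := hclose j b hb
          exact hF i j hij u hu v hv (((h1.trans h).trans h2.symm).mono (by omega))
      Sc := fun x hx i b hb h => a6 i x hx b hb h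
      Tc := fun x hx i b hb h => a7 i x hx b hb h }
  by_cases hsep : ∀ ξ : Fin (k + 1) → ℕ, (∀ i, ξ i ≤ R.n i) → ∃ Z, ST G S T Z ∧
      ∀ v ∈ Z, ∀ i, ¬ Nr G (E + s) v (R.P i (ξ i))
  · left
    obtain ⟨J, ⟨M⟩⟩ := build R (η := η) c Rc (by omega) (by omega) he (by omega : 2 * e ≤ E) (by omega)
      (by omega) hsep
    obtain ⟨W, h1, h2, h3⟩ := hU V G hG M.AS
    exact M.assemble (by omega) (by omega) (by omega) h1 h2 (fun x hx y hy h => (h3 x hx y hy h).conn)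
  · right
    push Not at hsep
    obtain ⟨ξ, hξ, h⟩ := hsep
    refine ⟨Finset.univ.image (fun i => R.P i (ξ i)), Finset.card_image_le.trans (by simp), ?_⟩
    intro Z' hZ'
    obtain ⟨v, hv, i, hi⟩ := h Z' hZ'
    exact ⟨v, hv, _, Finset.mem_image_of_mem _ (Finset.mem_univ i), hi.mono (le_max_right _ _)⟩

theorem mainK (p q k : ℕ) (hp : 1 ≤ p) : MainK p q k := by
  induction k with
  | zero => exact mainK_zero p q
  | succ k ih => exact mainK_succ p q k hp ih
end CM

/-- Coarse Menger for graphs of bounded coarse path-width. -/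
theorem coarseMenger_of_coarse_pathwidth (k c p q : ℕ) (hc : 1 ≤ c) (hp : 1 ≤ p)
    (hq : 1 ≤ q) :
    ∃ ℓ : ℕ, ∀ (V : Type) [Fintype V], ∀ G : SimpleGraph V, HasPQPathDecomp G p q →
      ∀ S T : Set V,
        (∃ (u v : Fin (k + 1) → V) (P : ∀ i, G.Walk (u i) (v i)),
          (∀ i, (P i).IsPath) ∧ (∀ i, u i ∈ S) ∧ (∀ i, v i ∈ T) ∧
          (∀ i j, i ≠ j →
            (c : ℕ∞) ≤ eSetDist G {x | x ∈ (P i).support} {x | x ∈ (P j).support})) ∨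
        (∃ X : Finset V, X.card ≤ k ∧
          ∀ (a b : V) (w : G.Walk a b), w.IsPath → a ∈ S → b ∈ T →
            ∃ y ∈ w.support, ∃ x ∈ X, eSetDist G {y} {x} ≤ (ℓ : ℕ∞)) := by
  classical
  obtain ⟨ℓ, hℓ⟩ := CM.mainK p q k hp c
  refine ⟨ℓ, fun V _ G hG S T => ?_⟩
  rcases hℓ V G hG S T with ⟨Z, hZ, hF⟩ | ⟨X, hX, hX'⟩
  · left
    choose u hu v hv w hw using hZ
    refine ⟨u, v, fun i => (w i).bypass, fun i => (w i).bypass_isPath, hu, hv, fun i j hij => ?_⟩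
    exact CM.le_eSetDist ((hF i j hij).mono le_rfl
      (fun x hx => hw i x ((w i).support_bypass_subset_support hx))
      (fun x hx => hw j x ((w j).support_bypass_subset_support hx)))
  · right
    refine ⟨X, hX, fun a b w _ ha hb => ?_⟩
    obtain ⟨y, hy, x, hx, h⟩ := hX' {x | x ∈ w.support} ⟨a, ha, b, hb, w, fun _ h => h⟩
    exact ⟨y, hy, x, hx, CM.eSetDist_le_iff.2 h⟩
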